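/- arXiv:1902.05198 — 8 statements merged into one kernel-verified Lean document; each statement's English description precedes it below -/
import Mathlib

section
/- Let K ∈ ℂ^{L+1}. Then K satisfies the prediction equations x_{k+1} = Σ_{l=0}^{L} K_l x_{k−l} for all k ∈ ℤ if and only if for every i ∈ {0, …, M−1} one has a_i · (ω^i − Σ_{l=0}^{L} K_l ω^{−l i}) = 0. -/
theorem isPrimitiveRoot_exp_neg (M : ℕ) (hM : M ≠ 0) :
    IsPrimitiveRoot (Complex.exp (-2 * Real.pi * Complex.I / M)) M := by
  have h := (Complex.isPrimitiveRoot_exp M hM).inv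
  rwa [← Complex.exp_neg, ← neg_div, ← neg_mul, ← neg_mul] at h

/-- An exponential sum over the powers of a primitive root of unity vanishes identically
iff all its coefficients vanish. -/
theorem IsPrimitiveRoot.forall_sum_mul_zpow_eq_zero_iff {F : Type*} [Field F] {M : ℕ} {ω : F}
    (hω : IsPrimitiveRoot ω M) (c : Fin M → F) :
    (∀ k : ℤ, ∑ i : Fin M, c i * ω ^ (k * ((i : ℕ) : ℤ)) = 0) ↔ ∀ i, c i = 0 := by
  refine ⟨fun h => ?_, fun h k => by simp [h]⟩
  have hinj : Function.Injective fun i : Fin M => ω ^ (i : ℕ) := fun i j hij =>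
    Fin.ext (hω.pow_inj i.isLt j.isLt hij)
  refine congrFun (Matrix.eq_zero_of_forall_index_sum_mul_pow_eq_zero hinj fun k => ?_)
  rw [← h (k : ℕ)]
  refine Finset.sum_congr rfl fun i _ => ?_
  rw [← pow_mul, ← Nat.cast_mul, zpow_natCast]

/-- Equivalence of the time-domain prediction equations with the spectral-domain
conditions: `K` gives perfect prediction iff for every Fourier index `i`,
`a i * (ω^i - ∑ l, K l * ω^(-l i)) = 0`. -/
theorem stmt4 (M : ℕ) (hM : 1 ≤ M) (L : ℕ) (a : Fin M → ℂ)
    (ω : ℂ) (hω : ω = Complex.exp (-2 * Real.pi * Complex.I / M))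
    (x : ℤ → ℂ)
    (hx : ∀ k : ℤ, x k = ∑ i : Fin M, a i * ω ^ (k * ((i : ℕ) : ℤ)))
    (K : Fin (L + 1) → ℂ) :
    (∀ k : ℤ, x (k + 1) = ∑ l : Fin (L + 1), K l * x (k - ((l : ℕ) : ℤ))) ↔
    (∀ i : Fin M,
      a i * (ω ^ (i : ℕ)
        - ∑ l : Fin (L + 1), K l * ω ^ (-((l : ℕ) : ℤ) * ((i : ℕ) : ℤ))) = 0) := by
  have hroot : IsPrimitiveRoot ω M := hω ▸ isPrimitiveRoot_exp_neg M (by lia)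
  have hω0 : ω ≠ 0 := hroot.ne_zero (by lia)
  rw [← hroot.forall_sum_mul_zpow_eq_zero_iff]
  refine forall_congr' fun k => ?_
  rw [← sub_eq_zero]
  refine Eq.congr_left ?_
  simp only [hx, Finset.mul_sum]
  rw [Finset.sum_comm, ← Finset.sum_sub_distrib]
  refine Finset.sum_congr rfl fun i _ => ?_
  rw [mul_sub, sub_mul, Finset.mul_sum, Finset.sum_mul]
  congr 1
  · rw [add_mul, one_mul, zpow_add₀ hω0, zpow_natCast ω i]
    ring
  · refine Finset.sum_congr rfl fun l _ => ?_
    rw [sub_eq_add_neg, add_mul, zpow_add₀ hω0]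
    ring
end

section
/- The linear system A_{I,L} K = b_I admits a solution K ∈ ℂ^{L+1} if and only if L ≥ P − 1. Moreover, when L = P − 1 the solution is unique. -/
open Polynomial in
/-- Multiplying a rectangular Vandermonde matrix by a vector evaluates, at the nodes, the polynomial
whose coefficients are the entries of the vector. -/
theorem vandermonde_mulVec_apply {F : Type*} [Field F] [DecidableEq F] {P n : ℕ} (z : Fin P → F)
    (K : Fin n → F) (p : Fin P) :
    (Matrix.of fun (p : Fin P) (l : Fin n) => z p ^ (l : ℕ)).mulVec K p =
      (ofFn n K).eval (z p) := by
  rw [ofFn_eq_sum_monomial, eval_finsetSum]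
  simp [Matrix.mulVec, dotProduct, mul_comm]

open Polynomial in
theorem exists_vandermonde_mulVec_eq {F : Type*} [Field F] {P n : ℕ} {z : Fin P → F}
    (hz : Function.Injective z) (hP : 1 ≤ P) (hn : P ≤ n) (b : Fin P → F) :
    ∃ K : Fin n → F, (Matrix.of fun (p : Fin P) (l : Fin n) => z p ^ (l : ℕ)).mulVec K = b := by
  classical
  set f := Lagrange.interpolate Finset.univ z b
  have hf : f.natDegree < n := by
    refine lt_of_lt_of_le ?_ hn
    by_cases h0 : f = 0
    · rw [h0, natDegree_zero]
      exact hP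
    rw [natDegree_lt_iff_degree_lt h0]
    simpa only [Finset.card_fin] using
      Lagrange.degree_interpolate_lt b (s := Finset.univ) hz.injOn
  refine ⟨toFn n f, funext fun p => ?_⟩
  rw [vandermonde_mulVec_apply, ofFn_comp_toFn_eq_id_of_natDegree_lt hf]
  exact Lagrange.eval_interpolate_at_node b hz.injOn (Finset.mem_univ p)

open Polynomial in
theorem vandermonde_mulVec_injective {F : Type*} [Field F] {P n : ℕ} {z : Fin P → F}
    (hz : Function.Injective z) (hn : n ≤ P) :
    Function.Injective (Matrix.of fun (p : Fin P) (l : Fin n) => z p ^ (l : ℕ)).mulVec := by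
  classical
  intro K K' h
  have hdeg (v : Fin n → F) : (ofFn n v).degree < (Finset.univ : Finset (Fin P)).card :=
    (ofFn_degree_lt v).trans_le (by simpa using hn)
  refine injective_ofFn n (eq_of_degrees_lt_of_eval_index_eq Finset.univ hz.injOn
    (hdeg K) (hdeg K') fun p _ => ?_)
  rw [← vandermonde_mulVec_apply, ← vandermonde_mulVec_apply, h]

open Polynomial in
/-- A polynomial of degree less than `n` agrees with `x ↦ x⁻¹` in at most `n` nonzero points. -/
theorem le_of_vandermonde_mulVec_eq_inv {F : Type*} [Field F] {P n : ℕ} {z : Fin P → F}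
    (hz : Function.Injective z) (hz0 : ∀ p, z p ≠ 0) {K : Fin n → F}
    (hK : (Matrix.of fun (p : Fin P) (l : Fin n) => z p ^ (l : ℕ)).mulVec K = fun p => (z p)⁻¹) :
    P ≤ n := by
  classical
  by_contra! hlt
  have hzero : X * ofFn n K - 1 = 0 := by
    refine eq_zero_of_degree_lt_of_eval_index_eq_zero Finset.univ hz.injOn ?_ fun p _ => ?_
    · refine lt_of_le_of_lt (b := (n : WithBot ℕ)) ?_ (by simpa using hlt)
      rw [degree_le_iff_coeff_zero]
      intro m hm
      have hm : n < m := by exact_mod_cast hm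
      obtain ⟨k, rfl⟩ : ∃ k, m = k + 1 := ⟨m - 1, by omega⟩
      simp [coeff_X_mul, ofFn_coeff_eq_zero_of_ge K (Nat.lt_succ_iff.1 hm), coeff_one]
    · have h := congrFun hK p
      rw [vandermonde_mulVec_apply] at h
      simp [h, hz0 p]
  simpa using congrArg (eval 0) hzero

/-- The linear system `A_{I,L} K = b_I` admits a solution iff `L ≥ P - 1`;
when `L = P - 1` the solution is unique. -/
theorem stmt6 (M P L : ℕ) (hM : 1 ≤ M) (hP : 1 ≤ P)
    (ω : ℂ) (hω : ω = Complex.exp (-2 * Real.pi * Complex.I / M))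
    (i : Fin P → Fin M) (hi : StrictMono i) :
    ((∃ K : Fin (L + 1) → ℂ,
        (Matrix.of fun (p : Fin P) (l : Fin (L + 1)) =>
            ω ^ (-((l : ℕ) : ℤ) * ((i p : ℕ) : ℤ))).mulVec K
          = fun p => ω ^ ((i p : ℕ))) ↔ P - 1 ≤ L) ∧
    (L = P - 1 →
      ∃! K : Fin (L + 1) → ℂ,
        (Matrix.of fun (p : Fin P) (l : Fin (L + 1)) =>
            ω ^ (-((l : ℕ) : ℤ) * ((i p : ℕ) : ℤ))).mulVec K
          = fun p => ω ^ ((i p : ℕ))) := by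
  have hprim : IsPrimitiveRoot ω⁻¹ M := by
    have h := Complex.isPrimitiveRoot_exp M (by omega)
    rwa [hω, ← Complex.exp_neg, neg_div', neg_mul, neg_mul, neg_neg]
  have hω0 : ω ≠ 0 := hω ▸ Complex.exp_ne_zero _
  set z : Fin P → ℂ := fun p => ω⁻¹ ^ (i p : ℕ) with hz_def
  have hz : Function.Injective z := fun p q h =>
    hi.injective (Fin.ext (hprim.pow_inj (i p).isLt (i q).isLt h))
  have hz0 (p : Fin P) : z p ≠ 0 := pow_ne_zero _ (inv_ne_zero hω0)
  have hA : (Matrix.of fun (p : Fin P) (l : Fin (L + 1)) =>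
      ω ^ (-((l : ℕ) : ℤ) * ((i p : ℕ) : ℤ))) =
      Matrix.of fun (p : Fin P) (l : Fin (L + 1)) => z p ^ (l : ℕ) := by
    ext p l
    simp only [Matrix.of_apply, hz_def]
    rw [← pow_mul, inv_pow, ← zpow_natCast, ← zpow_neg]
    congr 1
    push_cast
    ring
  have hb : (fun p => ω ^ (i p : ℕ)) = fun p => (z p)⁻¹ := by
    simp [hz_def]
  rw [hA, hb]
  refine ⟨⟨?_, fun hL => exists_vandermonde_mulVec_eq hz hP (by omega) _⟩, fun hL => ?_⟩
  · rintro ⟨K, hK⟩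
    have := le_of_vandermonde_mulVec_eq_inv hz hz0 hK
    omega
  · obtain ⟨K, hK⟩ := exists_vandermonde_mulVec_eq (n := L + 1) hz hP (by omega) fun p => (z p)⁻¹
    exact ⟨K, hK, fun K' hK' =>
      vandermonde_mulVec_injective hz (by omega) (hK'.trans hK.symm)⟩
end

section
/- Suppose the signal x is real-valued (equivalently a_{(M−i) mod M} = conj(a_i) for all i) and has exactly P ≥ 1 nonzero Fourier coefficients, i.e., #{i ∈ {0,…,M−1} : a_i ≠ 0} = P. Then the minimal number of time delays L ∈ ℕ for which there exists a real vector K ∈ ℝ^{L+1} satisfying the prediction equations x_{k+1} = Σ_{l=0}^{L} K_l x_{k−l} for all k ∈ ℤ is L = P − 1: no such real K exists for L < P − 1, a real K exists for every L ≥ P − 1, and when L = P − 1 the solution K is unique. -/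
open Polynomial in
/-- The nodes in `s` satisfy a common linear recurrence of any order `L + 1 ≥ #s`. -/
lemma exists_recurrence_of_card_le (s : Finset ℂ) (L : ℕ) (hL : s.card ≤ L + 1) :
    ∃ K : Fin (L + 1) → ℂ, ∀ z ∈ s,
      z ^ (L + 1) = ∑ l : Fin (L + 1), K l * z ^ (L - (l : ℕ)) := by
  set g : ℂ[X] := (∏ w ∈ s, (X - C w)) * X ^ (L + 1 - s.card) with hg
  have hf : (∏ w ∈ s, (X - C w) : ℂ[X]).Monic := monic_prod_of_monic _ _ fun w _ => monic_X_sub_C w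
  have hmonic : g.Monic := hf.mul (monic_X_pow _)
  have hdeg : g.natDegree = L + 1 := by
    rw [hg, hf.natDegree_mul (monic_X_pow _), natDegree_X_pow,
      natDegree_prod_of_monic _ _ fun w _ => monic_X_sub_C w]
    simp only [natDegree_X_sub_C, Finset.sum_const, smul_eq_mul, mul_one]
    omega
  refine ⟨fun l => -g.coeff (L - l), fun z hz => ?_⟩
  have hroot : g.eval z = 0 := by
    rw [hg, eval_mul, eval_prod, Finset.prod_eq_zero hz (by simp), zero_mul]
  rw [eval_eq_sum_range, hdeg, Finset.sum_range_succ, ← hdeg, hmonic.coeff_natDegree, hdeg,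
    one_mul, ← Finset.sum_range_reflect] at hroot
  rw [Fin.sum_univ_eq_sum_range (fun l => -g.coeff (L - l) * z ^ (L - l))]
  simp only [Nat.add_sub_cancel] at hroot
  simp only [neg_mul, Finset.sum_neg_distrib]
  linear_combination hroot

/-- A polynomial expression of degree at most `L` vanishing at more than `L` points has zero
coefficients. -/
lemma coeff_eq_zero_of_sum_pow_eq_zero (s : Finset ℂ) (L : ℕ) (hL : L + 1 ≤ s.card)
    (c : Fin (L + 1) → ℂ) (hc : ∀ z ∈ s, ∑ l : Fin (L + 1), c l * z ^ (L - (l : ℕ)) = 0) :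
    c = 0 := by
  obtain ⟨e⟩ : Nonempty (Fin (L + 1) ↪ s) := by
    rw [Function.Embedding.nonempty_iff_card_le]; simpa using hL
  have hinj : Function.Injective fun j => (e j : ℂ) := Subtype.val_injective.comp e.injective
  have hrev := Matrix.eq_zero_of_forall_index_sum_mul_pow_eq_zero hinj (v := fun l => c l.rev)
    (fun j => by
      rw [← hc _ (e j).2, ← Equiv.sum_comp Fin.revPerm]
      refine Finset.sum_congr rfl fun l _ => ?_
      simp only [Fin.revPerm_apply, Fin.rev_rev, Fin.val_rev]
      congr 2; omega)
  funext l
  simpa using congrFun hrev l.rev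

/-- A superposition of geometric sequences with distinct nonzero ratios satisfies a linear
recurrence exactly when every ratio with nonzero amplitude does. -/
lemma superposition_recurrence_iff {M : ℕ} (a z : Fin M → ℂ) (hz : Function.Injective z)
    (hz0 : ∀ i, z i ≠ 0) (x : ℤ → ℂ) (hx : ∀ k, x k = ∑ i, a i * z i ^ k)
    (L : ℕ) (K : Fin (L + 1) → ℂ) :
    (∀ k : ℤ, x (k + 1) = ∑ l : Fin (L + 1), K l * x (k - ((l : ℕ) : ℤ))) ↔
      ∀ i, a i ≠ 0 → z i ^ (L + 1) = ∑ l : Fin (L + 1), K l * z i ^ (L - (l : ℕ)) := by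
  have key : ∀ k : ℤ, x (k + 1) - ∑ l : Fin (L + 1), K l * x (k - ((l : ℕ) : ℤ)) =
      ∑ i, (a i * (z i ^ (L + 1) - ∑ l : Fin (L + 1), K l * z i ^ (L - (l : ℕ)))) *
        z i ^ (k - L) := by
    intro k
    simp only [hx, Finset.mul_sum]
    rw [Finset.sum_comm, ← Finset.sum_sub_distrib]
    refine Finset.sum_congr rfl fun i _ => ?_
    rw [mul_sub, sub_mul, Finset.mul_sum, Finset.sum_mul]
    congr 1
    · rw [mul_assoc, ← zpow_natCast, ← zpow_add₀ (hz0 i)]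
      congr 2; push_cast; ring
    · refine Finset.sum_congr rfl fun l _ => ?_
      have h : z i ^ (k - ((l : ℕ) : ℤ)) = z i ^ (L - (l : ℕ)) * z i ^ (k - L) := by
        rw [← zpow_natCast, ← zpow_add₀ (hz0 i), Nat.cast_sub (Nat.lt_succ_iff.mp l.2)]
        congr 1; ring
      rw [h]; ring
  constructor
  · intro h i hi
    have hzero := Matrix.eq_zero_of_forall_pow_sum_mul_pow_eq_zero hz
      (v := fun i => a i * (z i ^ (L + 1) - ∑ l : Fin (L + 1), K l * z i ^ (L - (l : ℕ))))
      (fun n => by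
        have hn := key (((n : ℕ) : ℤ) + L)
        rw [h, sub_self] at hn
        simpa using hn.symm)
    have hi' := congrFun hzero i
    exact sub_eq_zero.mp ((mul_eq_zero.mp hi').resolve_left hi)
  · intro h k
    rw [← sub_eq_zero, key]
    refine Finset.sum_eq_zero fun i _ => ?_
    by_cases hi : a i = 0
    · simp [hi]
    · rw [h i hi]; simp

/-- Over a conjugation-stable set of nodes, the real part of a recurrence is a recurrence. -/
lemma recurrence_re (s : Finset ℂ) (hs : ∀ z ∈ s, starRingEnd ℂ z ∈ s) (L : ℕ)
    (K : Fin (L + 1) → ℂ)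
    (hK : ∀ z ∈ s, z ^ (L + 1) = ∑ l : Fin (L + 1), K l * z ^ (L - (l : ℕ))) :
    ∀ z ∈ s, z ^ (L + 1) = ∑ l : Fin (L + 1), ((K l).re : ℂ) * z ^ (L - (l : ℕ)) := by
  intro z hz
  have hconj := congrArg (starRingEnd ℂ) (hK _ (hs z hz))
  simp only [map_pow, map_sum, map_mul, Complex.conj_conj] at hconj
  have hsum : ∑ l : Fin (L + 1), ((K l).re : ℂ) * z ^ (L - (l : ℕ)) =
      (∑ l : Fin (L + 1), K l * z ^ (L - (l : ℕ)) +
        ∑ l : Fin (L + 1), starRingEnd ℂ (K l) * z ^ (L - (l : ℕ))) / 2 := by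
    rw [← Finset.sum_add_distrib, Finset.sum_div]
    refine Finset.sum_congr rfl fun l _ => ?_
    rw [Complex.re_eq_add_conj]; ring
  rw [hsum, ← hK z hz, ← hconj]; ring

/-- For a real-valued `M`-periodic signal with exactly `P ≥ 1` nonzero Fourier
coefficients, the minimal number of time delays for perfect linear prediction with a
real coefficient vector is `P - 1`: no real solution exists for `L < P - 1`, a real
solution exists for all `L ≥ P - 1`, and at `L = P - 1` it is unique. -/
theorem stmt7 (M P : ℕ) (hM : 0 < M) (hP : 1 ≤ P) (a : Fin M → ℂ)
    (ω : ℂ) (hω : ω = Complex.exp (-2 * Real.pi * Complex.I / M))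
    (x : ℤ → ℂ)
    (hx : ∀ k : ℤ, x k = ∑ i : Fin M, a i * ω ^ (k * ((i : ℕ) : ℤ)))
    (hreal : ∀ i : Fin M,
      a ⟨(M - (i : ℕ)) % M, Nat.mod_lt _ hM⟩ = starRingEnd ℂ (a i))
    (hcard : (Finset.univ.filter fun i => a i ≠ 0).card = P) :
    (∀ L : ℕ, L < P - 1 →
      ¬ ∃ K : Fin (L + 1) → ℝ,
        ∀ k : ℤ, x (k + 1) = ∑ l : Fin (L + 1), (K l : ℂ) * x (k - ((l : ℕ) : ℤ))) ∧
    (∀ L : ℕ, P - 1 ≤ L →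
      ∃ K : Fin (L + 1) → ℝ,
        ∀ k : ℤ, x (k + 1) = ∑ l : Fin (L + 1), (K l : ℂ) * x (k - ((l : ℕ) : ℤ))) ∧
    (∃! K : Fin (P - 1 + 1) → ℝ,
        ∀ k : ℤ, x (k + 1) = ∑ l : Fin (P - 1 + 1), (K l : ℂ) * x (k - ((l : ℕ) : ℤ))) := by
  have hprim : IsPrimitiveRoot ω M := by
    have h := (Complex.isPrimitiveRoot_exp M hM.ne').inv
    rw [← Complex.exp_neg] at h
    rwa [hω, show (-2 * Real.pi * Complex.I / M : ℂ) = -(2 * Real.pi * Complex.I / M) by ring]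
  have hω0 : ω ≠ 0 := hprim.ne_zero hM.ne'
  have hωconj : starRingEnd ℂ ω = ω⁻¹ := by
    rw [← Complex.inv_eq_conj (hprim.norm'_eq_one hM.ne')]
  set z : Fin M → ℂ := fun i => ω ^ (i : ℕ) with hzdef
  have hz : Function.Injective z := fun i j hij => Fin.ext (hprim.pow_inj i.2 j.2 hij)
  have hz0 : ∀ i, z i ≠ 0 := fun i => pow_ne_zero _ hω0
  have hxz : ∀ k, x k = ∑ i, a i * z i ^ k := by
    intro k
    rw [hx]
    refine Finset.sum_congr rfl fun i _ => ?_
    rw [hzdef, mul_comm k, zpow_mul, zpow_natCast]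
  set s : Finset ℂ := (Finset.univ.filter fun i => a i ≠ 0).image z with hsdef
  have hscard : s.card = P := by rw [hsdef, Finset.card_image_of_injective _ hz, hcard]
  have hsconj : ∀ w ∈ s, starRingEnd ℂ w ∈ s := by
    intro w hw
    obtain ⟨i, hi, rfl⟩ := Finset.mem_image.mp hw
    refine Finset.mem_image.mpr ⟨⟨(M - (i : ℕ)) % M, Nat.mod_lt _ hM⟩, ?_, ?_⟩
    · simpa [hreal i] using hi
    · simp only [hzdef, map_pow, hωconj]
      rw [← pow_eq_pow_mod _ hprim.pow_eq_one, inv_pow]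
      refine eq_inv_of_mul_eq_one_left ?_
      rw [← pow_add, Nat.sub_add_cancel i.2.le, hprim.pow_eq_one]
  have hiff : ∀ (L : ℕ) (K : Fin (L + 1) → ℝ),
      (∀ k : ℤ, x (k + 1) = ∑ l : Fin (L + 1), (K l : ℂ) * x (k - ((l : ℕ) : ℤ))) ↔
        ∀ w ∈ s, w ^ (L + 1) = ∑ l : Fin (L + 1), (K l : ℂ) * w ^ (L - (l : ℕ)) := by
    intro L K
    rw [superposition_recurrence_iff a z hz hz0 x hxz L fun l => (K l : ℂ)]
    simp [hsdef]
  have hexists : ∀ L : ℕ, P - 1 ≤ L → ∃ K : Fin (L + 1) → ℝ,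
      ∀ k : ℤ, x (k + 1) = ∑ l : Fin (L + 1), (K l : ℂ) * x (k - ((l : ℕ) : ℤ)) := by
    intro L hL
    obtain ⟨K, hK⟩ := exists_recurrence_of_card_le s L (by omega)
    exact ⟨fun l => (K l).re, (hiff L _).mpr (recurrence_re s hsconj L K hK)⟩
  refine ⟨?_, hexists, ?_⟩
  · rintro L hL ⟨K, hK⟩
    rw [hiff] at hK
    have hzero := coeff_eq_zero_of_sum_pow_eq_zero s (L + 1) (by omega)
      (Fin.cons 1 fun l => -(K l : ℂ)) (fun w hw => by
        rw [Fin.sum_univ_succ]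
        simp [hK w hw])
    simpa using congrFun hzero 0
  · obtain ⟨K, hK⟩ := hexists (P - 1) le_rfl
    refine ⟨K, hK, fun K' hK' => ?_⟩
    rw [hiff] at hK
    have hK'' := (hiff _ _).mp hK'
    have hzero := coeff_eq_zero_of_sum_pow_eq_zero s (P - 1) (by omega)
      (fun l => (K' l : ℂ) - (K l : ℂ)) (fun w hw => by
        simp only [sub_mul, Finset.sum_sub_distrib]
        rw [← hK w hw, ← hK'' w hw, sub_self])
    funext l
    exact_mod_cast sub_eq_zero.mp (congrFun hzero l)
end

section
/- Suppose the Fourier spectrum of the real-valued signal x is dense, i.e., a_i ≠ 0 for every i ∈ {0, …, M−1}. Then for every L < M − 1 there is no K ∈ ℂ^{L+1} satisfying the prediction equations x_{k+1} = Σ_{l=0}^{L} K_l x_{k−l} for all k ∈ ℤ, while for L = M − 1 a real solution exists; i.e., the maximum number of time delays M − 1 is necessary and sufficient to perfectly recover the signal. -/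
open Polynomial in
/-- A monic recurrence of order `n` cannot have more than `n` distinct characteristic roots. -/
theorem not_forall_pow_eq_sum {R : Type*} [CommRing R] [IsDomain R] {M n : ℕ} (hn : n < M)
    {z : Fin M → R} (hz : Function.Injective z) (K : Fin n → R) :
    ¬ ∀ i, z i ^ n = ∑ l : Fin n, K l * z i ^ (l : ℕ) := by
  intro h
  have hdeg : degree (∑ l : Fin n, C (K l) * X ^ (l : ℕ)) < n := degree_sum_fin_lt K
  have hmonic : (X ^ n - ∑ l : Fin n, C (K l) * X ^ (l : ℕ) : R[X]).Monic :=
    monic_X_pow_sub hdeg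
  have hnat : (X ^ n - ∑ l : Fin n, C (K l) * X ^ (l : ℕ) : R[X]).natDegree = n := by
    refine natDegree_eq_of_degree_eq_some ?_
    rw [degree_sub_eq_left_of_degree_lt (by rwa [degree_X_pow]), degree_X_pow]
  refine hmonic.ne_zero (eq_zero_of_natDegree_lt_card_of_eval_eq_zero _ hz (fun i => ?_) ?_)
  · simp [eval_finsetSum, h i]
  · simpa [hnat] using hn

/-- If a combination, with nonzero coefficients, of the geometric sequences of distinct nonzero
ratios `z i` satisfies a linear recurrence, then so does each geometric sequence. -/
theorem eq_sum_zpow_of_forall_sum_zpow {F : Type*} [Field F] {M n : ℕ} {z a : Fin M → F}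
    (hz : Function.Injective z) (hz0 : ∀ i, z i ≠ 0) (ha : ∀ i, a i ≠ 0) (K : Fin n → F)
    (h : ∀ k : ℤ, ∑ i, a i * z i ^ (k + 1) =
      ∑ l : Fin n, K l * ∑ i, a i * z i ^ (k - ((l : ℕ) : ℤ))) (i : Fin M) :
    z i = ∑ l : Fin n, K l * z i ^ (-((l : ℕ) : ℤ)) := by
  have hzero : (fun i => a i * (z i - ∑ l : Fin n, K l * z i ^ (-((l : ℕ) : ℤ)))) = 0 := by
    refine Matrix.eq_zero_of_forall_pow_sum_mul_pow_eq_zero hz fun k => ?_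
    have hk := h ((k : ℕ) : ℤ)
    rw [← sub_eq_zero] at hk
    rw [← hk]
    simp_rw [Finset.mul_sum]
    rw [Finset.sum_comm, ← Finset.sum_sub_distrib]
    refine Finset.sum_congr rfl fun i _ => ?_
    rw [zpow_add_one₀ (hz0 i), zpow_natCast, mul_sub, sub_mul, Finset.mul_sum, Finset.sum_mul]
    congr 1
    · ring
    · refine Finset.sum_congr rfl fun l _ => ?_
      rw [sub_eq_add_neg, zpow_add₀ (hz0 i), zpow_natCast]
      ring
  exact sub_eq_zero.mp ((mul_eq_zero.mp (congrFun hzero i)).resolve_left (ha i))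

/-- For a real-valued `M`-periodic signal with dense Fourier spectrum (all `a i ≠ 0`),
no linear model with fewer than `M - 1` delays can perfectly predict the signal,
while `M - 1` delays and a real coefficient vector suffice. -/
theorem stmt9 (M : ℕ) (hM : 0 < M) (a : Fin M → ℂ)
    (ω : ℂ) (hω : ω = Complex.exp (-2 * Real.pi * Complex.I / M))
    (x : ℤ → ℂ)
    (hx : ∀ k : ℤ, x k = ∑ i : Fin M, a i * ω ^ (k * ((i : ℕ) : ℤ)))
    (hreal : ∀ i : Fin M,
      a ⟨(M - (i : ℕ)) % M, Nat.mod_lt _ hM⟩ = starRingEnd ℂ (a i))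
    (hdense : ∀ i : Fin M, a i ≠ 0) :
    (∀ L : ℕ, L < M - 1 →
      ¬ ∃ K : Fin (L + 1) → ℂ,
        ∀ k : ℤ, x (k + 1) = ∑ l : Fin (L + 1), K l * x (k - ((l : ℕ) : ℤ))) ∧
    (∃ K : Fin (M - 1 + 1) → ℝ,
      ∀ k : ℤ, x (k + 1) = ∑ l : Fin (M - 1 + 1), (K l : ℂ) * x (k - ((l : ℕ) : ℤ))) := by
  have hprim : IsPrimitiveRoot ω M := by
    have h := (Complex.isPrimitiveRoot_exp M hM.ne').inv
    rwa [← Complex.exp_neg, ← neg_div, ← neg_mul, ← neg_mul, ← hω] at h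
  have hω0 : ω ≠ 0 := hprim.ne_zero hM.ne'
  refine ⟨fun L hL ⟨K, hK⟩ => ?_, ?_⟩
  · have hz : Function.Injective fun i : Fin M => ω ^ (i : ℕ) :=
      fun i j hij => Fin.ext (hprim.pow_inj i.2 j.2 hij)
    have hx' (k : ℤ) : x k = ∑ i : Fin M, a i * (ω ^ (i : ℕ)) ^ k := by
      rw [hx]
      refine Finset.sum_congr rfl fun i _ => ?_
      rw [mul_comm k, zpow_mul, zpow_natCast]
    simp_rw [hx'] at hK
    have hroot := eq_sum_zpow_of_forall_sum_zpow hz (fun i => pow_ne_zero _ hω0) hdense K hK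
    refine not_forall_pow_eq_sum (by omega : L + 1 < M) hz (fun l => K l.rev) fun i => ?_
    have hi0 : ω ^ (i : ℕ) ≠ 0 := pow_ne_zero _ hω0
    rw [pow_succ]
    nth_rewrite 2 [hroot i]
    rw [Finset.mul_sum, ← Equiv.sum_comp Fin.revPerm]
    refine Finset.sum_congr rfl fun l _ => ?_
    have hl : (((l.rev : Fin (L + 1)) : ℕ) : ℤ) = L - (l : ℕ) := by
      have := l.2
      rw [Fin.val_rev]
      omega
    rw [Fin.revPerm_apply, mul_left_comm, hl, ← zpow_natCast _ L, ← zpow_add₀ hi0,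
      ← zpow_natCast _ (l : ℕ)]
    congr 2
    ring
  · refine ⟨Pi.single (Fin.last (M - 1)) 1, fun k => ?_⟩
    rw [Finset.sum_eq_single (Fin.last (M - 1)) (fun l _ hl => by simp [hl]) (by simp),
      Pi.single_eq_same, Complex.ofReal_one, one_mul, hx, hx]
    refine Finset.sum_congr rfl fun i _ => ?_
    have hk : (k + 1) * ((i : ℕ) : ℤ) =
        (k - ((Fin.last (M - 1) : ℕ) : ℤ)) * ((i : ℕ) : ℤ) + (M : ℤ) * ((i : ℕ) : ℤ) := by
      rw [Fin.val_last, Nat.cast_sub hM]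
      push_cast
      ring
    rw [hk, zpow_add₀ hω0, zpow_mul ω (M : ℤ), zpow_natCast ω M, hprim.pow_eq_one, one_zpow, mul_one]
end

section
/- There exists a real matrix K̃ ∈ ℝ^{J(L+1)×J} such that x̃_{k+1} = K̃ᵀ Ỹ_k for all k ∈ ℤ if and only if rank([D₁F, D₂F, …, D_JF]) = rank([D₁F, …, D_JF, D₁g, …, D_Jg]), where D_j = diag(a^{(j)}) ∈ ℂ^{M×M}, F ∈ ℂ^{M×(L+1)} has entries F_{i,l} = ω^{−l·i} (0 ≤ i ≤ M−1, 0 ≤ l ≤ L), and g ∈ ℂ^M has entries g_i = ω^{i}. -/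
/-- Adjoining columns `B` to `A` preserves the rank iff every new column is a combination of the
columns of `A`. -/
theorem rank_eq_rank_sumElim_iff {m n r : Type*} [Fintype m] [Fintype n] [Fintype r]
    {𝕜 : Type*} [Field 𝕜] (A : m → n → 𝕜) (B : m → r → 𝕜) :
    (Matrix.of A).rank = (Matrix.of fun i (q : n ⊕ r) => Sum.elim (A i) (B i) q).rank ↔
      ∃ C : n → r → 𝕜, ∀ i j, B i j = ∑ p, C p j * A i p := by
  have hle : Submodule.span 𝕜 (Set.range (Matrix.of A).col) ≤
      Submodule.span 𝕜 (Set.range (Matrix.of fun i (q : n ⊕ r) => Sum.elim (A i) (B i) q).col) := by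
    refine Submodule.span_mono ?_
    rintro _ ⟨p, rfl⟩
    exact ⟨Sum.inl p, rfl⟩
  rw [Matrix.rank_eq_finrank_span_cols, Matrix.rank_eq_finrank_span_cols]
  constructor
  · intro h
    have hmem : ∀ j : r, ∃ c : n → 𝕜, ∑ p, c p • (Matrix.of A).col p = fun i => B i j := by
      intro j
      rw [← Submodule.mem_span_range_iff_exists_fun, Submodule.eq_of_le_of_finrank_eq hle h]
      exact Submodule.subset_span ⟨Sum.inr j, rfl⟩
    choose c hc using hmem
    refine ⟨fun p j => c j p, fun i j => ?_⟩
    simpa [Finset.sum_apply] using (congrFun (hc j) i).symm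
  · rintro ⟨C, hC⟩
    refine congrArg (fun S : Submodule 𝕜 (m → 𝕜) => Module.finrank 𝕜 S) (le_antisymm hle ?_)
    rw [Submodule.span_le]
    rintro _ ⟨p | j, rfl⟩
    · exact Submodule.subset_span ⟨p, rfl⟩
    · refine (Submodule.mem_span_range_iff_exists_fun 𝕜).2 ⟨fun p => C p j, ?_⟩
      ext i
      simpa [Finset.sum_apply] using (hC i j).symm

/-- A trigonometric sum over a primitive `M`-th root of unity that vanishes at every integer has
zero coefficients. -/
theorem IsPrimitiveRoot.eq_zero_of_forall_sum_mul_zpow_eq_zero {𝕜 : Type*} [Field 𝕜] {M : ℕ}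
    {ω : 𝕜} (hω : IsPrimitiveRoot ω M) {c : Fin M → 𝕜}
    (h : ∀ k : ℤ, ∑ i : Fin M, c i * ω ^ (k * ((i : ℕ) : ℤ)) = 0) : c = 0 := by
  have hinj : Function.Injective fun i : Fin M => ω ^ (i : ℕ) := fun i j hij =>
    Fin.ext (hω.pow_inj i.2 j.2 hij)
  refine Matrix.eq_zero_of_forall_index_sum_mul_pow_eq_zero hinj fun k => ?_
  rw [← h ((k : ℕ) : ℤ)]
  refine Finset.sum_congr rfl fun i _ => ?_
  rw [← pow_mul, ← Nat.cast_mul, zpow_natCast]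

/-- Reflective symmetry of the coefficients makes the signal real. -/
theorem conj_sum_mul_zpow_eq_self {M : ℕ} (hM : 0 < M) {ω : ℂ} (hω : IsPrimitiveRoot ω M)
    {a : Fin M → ℂ}
    (ha : ∀ i : Fin M, a ⟨(M - (i : ℕ)) % M, Nat.mod_lt _ hM⟩ = starRingEnd ℂ (a i)) (k : ℤ) :
    starRingEnd ℂ (∑ i : Fin M, a i * ω ^ (k * ((i : ℕ) : ℤ))) =
      ∑ i : Fin M, a i * ω ^ (k * ((i : ℕ) : ℤ)) := by
  have hconj : starRingEnd ℂ ω = ω⁻¹ :=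
    (Complex.inv_eq_conj (hω.norm'_eq_one hM.ne')).symm
  have hinv : Function.Involutive fun i : Fin M =>
      (⟨(M - (i : ℕ)) % M, Nat.mod_lt _ hM⟩ : Fin M) := by
    intro i
    ext
    rcases Nat.eq_zero_or_pos (i : ℕ) with h0 | h0
    · simp [h0]
    · have hi := i.2
      simp only
      rw [Nat.mod_eq_of_lt (show M - (i : ℕ) < M by omega), Nat.mod_eq_of_lt (by omega)]
      omega
  rw [map_sum, ← Equiv.sum_comp (hinv.toPerm _)]
  refine Finset.sum_congr rfl fun i _ => ?_
  have hperm : hinv.toPerm _ i = (⟨(M - (i : ℕ)) % M, Nat.mod_lt _ hM⟩ : Fin M) := rfl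
  rw [hperm, map_mul, ha, Complex.conj_conj, map_zpow₀, hconj, inv_zpow']
  congr 1
  have hdvd : (M : ℤ) ∣ (i : ℕ) + ((M - (i : ℕ)) % M : ℕ) := by
    rw [← Nat.cast_add, Int.natCast_dvd_natCast, Nat.dvd_iff_mod_eq_zero, Nat.add_mod_mod,
      Nat.add_sub_cancel' i.2.le, Nat.mod_self]
  have hone := (hω.zpow_eq_one_iff_dvd _).2 (hdvd.mul_left k)
  rw [mul_add, zpow_add₀ (hω.ne_zero hM.ne')] at hone
  rw [zpow_neg]
  exact (eq_inv_of_mul_eq_one_left hone).symm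

/-- Vector case: a real delay transition matrix `K̃` with `x̃_{k+1} = K̃ᵀ Ỹ_k` exists
iff the rank of the stacked matrix `[D₁F, …, D_JF]` equals the rank of the augmented
matrix `[D₁F, …, D_JF, D₁g, …, D_Jg]`. -/
theorem stmt11 (M J L : ℕ) (hM : 0 < M) (hJ : 0 < J)
    (ω : ℂ) (hω : ω = Complex.exp (-2 * Real.pi * Complex.I / M))
    (a : Fin J → Fin M → ℂ)
    (hreal : ∀ (j : Fin J) (i : Fin M),
      a j ⟨(M - (i : ℕ)) % M, Nat.mod_lt _ hM⟩ = starRingEnd ℂ (a j i))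
    (x : Fin J → ℤ → ℂ)
    (hx : ∀ (j : Fin J) (k : ℤ),
      x j k = ∑ i : Fin M, a j i * ω ^ (k * ((i : ℕ) : ℤ))) :
    (∃ K : (Fin J × Fin (L + 1)) → Fin J → ℝ,
      ∀ (k : ℤ) (j : Fin J),
        x j (k + 1)
          = ∑ p : Fin J × Fin (L + 1), (K p j : ℂ) * x p.1 (k - ((p.2 : ℕ) : ℤ))) ↔
    (Matrix.of fun (i : Fin M) (p : Fin J × Fin (L + 1)) =>
        a p.1 i * ω ^ (-((p.2 : ℕ) : ℤ) * ((i : ℕ) : ℤ))).rank =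
    (Matrix.of fun (i : Fin M) (q : (Fin J × Fin (L + 1)) ⊕ Fin J) =>
        Sum.elim
          (fun p : Fin J × Fin (L + 1) =>
            a p.1 i * ω ^ (-((p.2 : ℕ) : ℤ) * ((i : ℕ) : ℤ)))
          (fun j : Fin J => a j i * ω ^ ((i : ℕ))) q).rank := by
  have hprim : IsPrimitiveRoot ω M := by
    have h := (Complex.isPrimitiveRoot_exp M hM.ne').inv
    rw [← Complex.exp_neg] at h
    rwa [hω, neg_mul, neg_mul, neg_div]
  have hω0 : ω ≠ 0 := hprim.ne_zero hM.ne'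
  have hxreal : ∀ j k, ((x j k).re : ℂ) = x j k := fun j k => by
    rw [← Complex.conj_eq_iff_re, hx]
    exact conj_sum_mul_zpow_eq_self hM hprim (hreal j) k
  have hresidual : ∀ (K : Fin J × Fin (L + 1) → ℂ) (k : ℤ) (j : Fin J),
      ∑ i : Fin M, (a j i * ω ^ (i : ℕ) -
          ∑ p, K p * (a p.1 i * ω ^ (-((p.2 : ℕ) : ℤ) * ((i : ℕ) : ℤ)))) *
            ω ^ (k * ((i : ℕ) : ℤ)) =
        x j (k + 1) - ∑ p, K p * x p.1 (k - ((p.2 : ℕ) : ℤ)) := by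
    intro K k j
    simp only [hx, sub_mul, Finset.sum_sub_distrib, Finset.sum_mul, Finset.mul_sum]
    rw [Finset.sum_comm]
    congr 1
    · refine Finset.sum_congr rfl fun i _ => ?_
      rw [add_mul, one_mul, zpow_add₀ hω0, zpow_natCast]
      ring
    · refine Finset.sum_congr rfl fun p _ => Finset.sum_congr rfl fun i _ => ?_
      rw [sub_eq_add_neg, ← neg_mul, zpow_add₀ hω0]
      ring
  rw [rank_eq_rank_sumElim_iff
    (fun (i : Fin M) (p : Fin J × Fin (L + 1)) =>
      a p.1 i * ω ^ (-((p.2 : ℕ) : ℤ) * ((i : ℕ) : ℤ)))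
    (fun (i : Fin M) (j : Fin J) => a j i * ω ^ (i : ℕ))]
  constructor
  · rintro ⟨K, hK⟩
    refine ⟨fun p j => (K p j : ℂ), fun i j => sub_eq_zero.1 ?_⟩
    exact congrFun (hprim.eq_zero_of_forall_sum_mul_zpow_eq_zero (c := fun i => _) fun k =>
      (hresidual (fun p => (K p j : ℂ)) k j).trans (sub_eq_zero.2 (hK k j))) i
  · rintro ⟨C, hC⟩
    refine ⟨fun p j => (C p j).re, fun k j => ?_⟩
    have h : x j (k + 1) = ∑ p, C p j * x p.1 (k - ((p.2 : ℕ) : ℤ)) := by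
      rw [← sub_eq_zero, ← hresidual (fun p => C p j) k j]
      exact Finset.sum_eq_zero fun i _ => by rw [hC i j, sub_self, zero_mul]
    rw [← hxreal, h, Complex.re_sum, Complex.ofReal_sum]
    refine Finset.sum_congr rfl fun p _ => ?_
    rw [← hxreal p.1, Complex.re_mul_ofReal, Complex.ofReal_mul]
end

section
/- For every L ≥ P − 1, the minimum-Euclidean-norm solution K̂_L of A_{I,L} K = b_I satisfies the tight bound ‖K̂_L‖₂² ≤ ‖K̂_{P−1}‖₂² / (1 + ⌊(L − P + 1)/M⌋). -/
/-- Tight upper bound on the squared Euclidean norm of the minimum-norm solution of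
`A_{I,L} K = b_I`:  `‖K̂_L‖₂² ≤ ‖K̂_{P−1}‖₂² / (1 + ⌊(L − P + 1)/M⌋)`. -/
theorem stmt14 (M P L : ℕ) (hM : 0 < M) (hP : 1 ≤ P) (hL : P - 1 ≤ L)
    (ω : ℂ) (hω : ω = Complex.exp (-2 * Real.pi * Complex.I / M))
    (i : Fin P → Fin M) (hi : StrictMono i)
    (KL : Fin (L + 1) → ℂ) (KP : Fin (P - 1 + 1) → ℂ)
    (hKL : (Matrix.of fun (p : Fin P) (l : Fin (L + 1)) =>
        ω ^ (-((l : ℕ) : ℤ) * ((i p : ℕ) : ℤ))).mulVec KL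
      = fun p => ω ^ ((i p : ℕ)))
    (hKLmin : ∀ K : Fin (L + 1) → ℂ,
      (Matrix.of fun (p : Fin P) (l : Fin (L + 1)) =>
          ω ^ (-((l : ℕ) : ℤ) * ((i p : ℕ) : ℤ))).mulVec K
        = (fun p => ω ^ ((i p : ℕ))) →
      ∑ l, ‖KL l‖ ^ 2 ≤ ∑ l, ‖K l‖ ^ 2)
    (hKP : (Matrix.of fun (p : Fin P) (l : Fin (P - 1 + 1)) =>
        ω ^ (-((l : ℕ) : ℤ) * ((i p : ℕ) : ℤ))).mulVec KP
      = fun p => ω ^ ((i p : ℕ)))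
    (hKPmin : ∀ K : Fin (P - 1 + 1) → ℂ,
      (Matrix.of fun (p : Fin P) (l : Fin (P - 1 + 1)) =>
          ω ^ (-((l : ℕ) : ℤ) * ((i p : ℕ) : ℤ))).mulVec K
        = (fun p => ω ^ ((i p : ℕ))) →
      ∑ l, ‖KP l‖ ^ 2 ≤ ∑ l, ‖K l‖ ^ 2) :
    ∑ l, ‖KL l‖ ^ 2 ≤ (∑ l, ‖KP l‖ ^ 2) / (1 + (((L + 1 - P) / M : ℕ) : ℝ)) := by
  have hPM : P ≤ M := by simpa using Fintype.card_le_of_injective i hi.injective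
  have hω0 : ω ≠ 0 := hω ▸ Complex.exp_ne_zero _
  have hM0 : (M : ℂ) ≠ 0 := by exact_mod_cast hM.ne'
  have hωM : ω ^ M = 1 := by
    rw [hω, ← Complex.exp_nat_mul,
      show (M : ℂ) * (-2 * Real.pi * Complex.I / M) = -(2 * Real.pi * Complex.I) by field_simp,
      Complex.exp_neg, Complex.exp_two_pi_mul_I, inv_one]
  set q := (L + 1 - P) / M
  have hqM : q * M ≤ L + 1 - P := Nat.div_mul_le_self _ _
  -- Spread `KP` evenly over `q + 1` disjoint translates by multiples of the period `M`.
  let e : Fin (q + 1) × Fin (P - 1 + 1) → Fin (L + 1) := fun x =>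
    ⟨x.2 + M * x.1, by
      have h₁ : M * (x.1 : ℕ) ≤ M * q := Nat.mul_le_mul_left _ (Nat.lt_succ_iff.mp x.1.2)
      have h₂ := x.2.2
      rw [mul_comm M q] at h₁
      omega⟩
  have he : Function.Injective e := by
    rintro ⟨r, j⟩ ⟨r', j'⟩ h
    have h : (j : ℕ) + M * r = j' + M * r' := congrArg Fin.val h
    have hj : (j : ℕ) < M := by omega
    have hj' : (j' : ℕ) < M := by omega
    have hmod := congrArg (· % M) h
    have hdiv := congrArg (· / M) h
    simp only [Nat.add_mul_mod_self_left, Nat.mod_eq_of_lt hj, Nat.mod_eq_of_lt hj'] at hmod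
    simp only [Nat.add_mul_div_left _ _ hM, Nat.div_eq_of_lt hj, Nat.div_eq_of_lt hj',
      zero_add] at hdiv
    exact Prod.ext (Fin.ext hdiv) (Fin.ext hmod)
  let K : Fin (L + 1) → ℂ := Function.extend e (fun x => KP x.2 / (q + 1)) 0
  have hK : ∀ x, K (e x) = KP x.2 / (q + 1) := fun x => he.extend_apply _ _ x
  have hK0 : ∀ l ∉ Set.range e, K l = 0 := fun l hl => Function.extend_apply' _ _ _ hl
  have hq0 : (q + 1 : ℂ) ≠ 0 := by exact_mod_cast q.succ_ne_zero
  refine (hKLmin K ?_).trans_eq ?_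
  · ext p
    have hp := congrFun hKP p
    simp only [Matrix.mulVec, dotProduct, Matrix.of_apply] at hp ⊢
    rw [← Fintype.sum_of_injective e he
      (fun x => ω ^ (-((x.2 : ℕ) : ℤ) * ((i p : ℕ) : ℤ)) * (KP x.2 / (q + 1))) _
      (fun l hl => by rw [hK0 l hl, mul_zero]) (fun x => ?_), Fintype.sum_prod_type]
    · simp only [mul_div_assoc', ← Finset.sum_div, hp]
      simp only [Finset.sum_const, Finset.card_univ, Fintype.card_fin, nsmul_eq_mul]
      push_cast
      field_simp
    · rw [hK]
      congr 1
      have : -(((e x : Fin (L + 1)) : ℕ) : ℤ) * ((i p : ℕ) : ℤ)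
          = -((x.2 : ℕ) : ℤ) * ((i p : ℕ) : ℤ) + (M : ℤ) * (-((x.1 : ℕ) * (i p : ℕ) : ℤ)) := by
        simp only [e]
        push_cast
        ring
      rw [this, zpow_add₀ hω0, zpow_mul ω M, zpow_natCast, hωM, one_zpow, mul_one]
  · rw [← Fintype.sum_of_injective e he (fun x => ‖KP x.2 / (q + 1)‖ ^ 2) _
      (fun l hl => by rw [hK0 l hl]; simp) (fun x => by rw [hK]), Fintype.sum_prod_type]
    have hn : ‖(q + 1 : ℂ)‖ = q + 1 := by exact_mod_cast Complex.norm_natCast (q + 1)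
    simp only [norm_div, hn, div_pow, ← Finset.sum_div, Finset.sum_const, Finset.card_univ,
      Fintype.card_fin, nsmul_eq_mul]
    push_cast
    rw [add_comm (1 : ℝ)]
    field_simp
end

section
/- The minimum-Euclidean-norm solutions K̂_L of A_{I,L} K = b_I satisfy lim_{L→∞} ‖K̂_L‖₂ = 0. -/
/-- The vector of length `n` that is constant on the indices `l` with `M ∣ l + 1`, where its entries
sum to one, and vanishes elsewhere. -/
noncomputable def residueAverage (M n : ℕ) (l : Fin n) : ℂ :=
  if M ∣ (l : ℕ) + 1 then ((n / M : ℕ) : ℂ)⁻¹ else 0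

theorem sum_fin_dvd_succ {R : Type*} [Semiring R] (M n : ℕ) (c : R) :
    ∑ l : Fin n, (if M ∣ (l : ℕ) + 1 then c else 0) = ((n / M : ℕ) : R) * c := by
  rw [Fin.sum_univ_eq_sum_range (fun l => if M ∣ l + 1 then c else 0) n, ← Finset.sum_filter,
    Finset.sum_const, Nat.card_multiples, nsmul_eq_mul]

theorem sum_norm_sq_residueAverage {M n : ℕ} (h : n / M ≠ 0) :
    ∑ l, ‖residueAverage M n l‖ ^ 2 = ((n / M : ℕ) : ℝ)⁻¹ := by
  have hterm (l : Fin n) : ‖residueAverage M n l‖ ^ 2 =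
      if M ∣ (l : ℕ) + 1 then (((n / M : ℕ) : ℝ)⁻¹) ^ 2 else 0 := by
    unfold residueAverage
    split_ifs
    · rw [norm_inv, Complex.norm_natCast]
    · simp
  have h' : ((n / M : ℕ) : ℝ) ≠ 0 := Nat.cast_ne_zero.mpr h
  simp_rw [hterm, sum_fin_dvd_succ]
  field_simp

theorem zpow_neg_mul_eq_pow_of_dvd_succ {ω : ℂ} {M : ℕ} (hω₀ : ω ≠ 0) (hω : ω ^ M = 1) {l : ℕ}
    (hl : M ∣ l + 1) (j : ℕ) : ω ^ (-(l : ℤ) * (j : ℤ)) = ω ^ j := by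
  obtain ⟨k, hk⟩ := hl
  have hexp : -(l : ℤ) * (j : ℤ) = (M : ℤ) * (-(k * j : ℤ)) + j := by
    have : (l : ℤ) = M * k - 1 := by
      have : (l : ℤ) + 1 = M * k := by exact_mod_cast hk
      linarith
    rw [this]
    ring
  rw [hexp, zpow_add₀ hω₀, zpow_mul, zpow_natCast, hω, one_zpow, one_mul, zpow_natCast]

theorem mulVec_residueAverage {ι : Type*} {ω : ℂ} {M n : ℕ} (hω₀ : ω ≠ 0) (hω : ω ^ M = 1)
    (h : n / M ≠ 0) (j : ι → ℕ) :
    (Matrix.of fun (p : ι) (l : Fin n) =>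
        ω ^ (-((l : ℕ) : ℤ) * (j p : ℤ))).mulVec (residueAverage M n) = fun p => ω ^ j p := by
  funext p
  have hterm (l : Fin n) : ω ^ (-((l : ℕ) : ℤ) * (j p : ℤ)) * residueAverage M n l =
      if M ∣ (l : ℕ) + 1 then ω ^ j p * ((n / M : ℕ) : ℂ)⁻¹ else 0 := by
    unfold residueAverage
    split_ifs with hl
    · rw [zpow_neg_mul_eq_pow_of_dvd_succ hω₀ hω hl]
    · simp
  have h' : ((n / M : ℕ) : ℂ) ≠ 0 := Nat.cast_ne_zero.mpr h
  simp only [Matrix.mulVec, dotProduct, Matrix.of_apply]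
  simp_rw [hterm, sum_fin_dvd_succ]
  field_simp

/-- The Euclidean norms of the minimum-norm solutions `K̂_L` of `A_{I,L} K = b_I`
tend to zero as the number of time delays `L → ∞`. -/
theorem stmt15 (M P : ℕ) (hM : 0 < M) (hP : 1 ≤ P)
    (ω : ℂ) (hω : ω = Complex.exp (-2 * Real.pi * Complex.I / M))
    (i : Fin P → Fin M) (hi : StrictMono i)
    (Khat : (L : ℕ) → Fin (L + 1) → ℂ)
    (hsol : ∀ L : ℕ, P - 1 ≤ L →
      (Matrix.of fun (p : Fin P) (l : Fin (L + 1)) =>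
          ω ^ (-((l : ℕ) : ℤ) * ((i p : ℕ) : ℤ))).mulVec (Khat L)
        = fun p => ω ^ ((i p : ℕ)))
    (hmin : ∀ L : ℕ, P - 1 ≤ L → ∀ K : Fin (L + 1) → ℂ,
      (Matrix.of fun (p : Fin P) (l : Fin (L + 1)) =>
          ω ^ (-((l : ℕ) : ℤ) * ((i p : ℕ) : ℤ))).mulVec K
        = (fun p => ω ^ ((i p : ℕ))) →
      ∑ l, ‖Khat L l‖ ^ 2 ≤ ∑ l, ‖K l‖ ^ 2) :
    Filter.Tendsto (fun L : ℕ => Real.sqrt (∑ l, ‖Khat L l‖ ^ 2))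
      Filter.atTop (nhds 0) := by
  have hω₀ : ω ≠ 0 := hω ▸ Complex.exp_ne_zero _
  have hωM : ω ^ M = 1 := by
    have hM' : (M : ℂ) ≠ 0 := Nat.cast_ne_zero.mpr hM.ne'
    rw [hω, ← Complex.exp_nat_mul, Complex.exp_eq_one_iff]
    exact ⟨-1, by push_cast; field_simp⟩
  have hdiv : Filter.Tendsto (fun L : ℕ => (L + 1) / M) Filter.atTop Filter.atTop :=
    (Nat.tendsto_div_const_atTop hM.ne').comp (Filter.tendsto_add_atTop_nat 1)
  have hbound : Filter.Tendsto (fun L : ℕ => (((L + 1) / M : ℕ) : ℝ)⁻¹) Filter.atTop (nhds 0) :=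
    tendsto_inv_atTop_zero.comp (tendsto_natCast_atTop_atTop.comp hdiv)
  have hsq : Filter.Tendsto (fun L : ℕ => ∑ l, ‖Khat L l‖ ^ 2) Filter.atTop (nhds 0) := by
    refine squeeze_zero' (Filter.Eventually.of_forall fun L => by positivity) ?_ hbound
    filter_upwards [Filter.eventually_ge_atTop (P - 1), hdiv.eventually_ne_atTop 0] with L hL hN
    exact (hmin L hL _ (mulVec_residueAverage hω₀ hωM hN fun p => (i p : ℕ))).trans_eq
      (sum_norm_sq_residueAverage hN)
  simpa using hsq.sqrt
end

section
/- Assume P ≥ 2 and let δ = min_{0 ≤ j < k ≤ P−1} |ω^{−i_j} − ω^{−i_k}| > 0. For every L ≥ P − 1, the 2-norm condition number of A_{I,L} satisfies κ₂(A_{I,L}) ≤ 1 + (d/2)·(1 + √(1 + 4/d)), where d = P·[ (1 + ‖K̂_{P−1}‖₂² / ((P−1)·(1 + ⌊(L − P + 1)/M⌋)·δ²) )^{(P−1)/2} − 1 ]. Consequently, κ₂(A_{I,L}) → 1 as L → ∞, i.e., perfect conditioning is achieved asymptotically. -/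
open Matrix

namespace Stmt16

/-- Largest singular value of a complex matrix: square root of the largest
eigenvalue of `A Aᴴ`. -/
noncomputable def sigmaMax {m n : ℕ} (A : Matrix (Fin m) (Fin n) ℂ) : ℝ :=
  Real.sqrt (⨆ p : Fin m, (Matrix.isHermitian_mul_conjTranspose_self A).eigenvalues p)

/-- Smallest (i.e. `m`-th largest) singular value of a complex matrix: square root
of the smallest eigenvalue of `A Aᴴ`. -/
noncomputable def sigmaMin {m n : ℕ} (A : Matrix (Fin m) (Fin n) ℂ) : ℝ :=
  Real.sqrt (⨅ p : Fin m, (Matrix.isHermitian_mul_conjTranspose_self A).eigenvalues p)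

/-- 2-norm condition number `κ₂(A) = σ_max(A) / σ_min(A)`. -/
noncomputable def cond2 {m n : ℕ} (A : Matrix (Fin m) (Fin n) ℂ) : ℝ :=
  sigmaMax A / sigmaMin A

/-- The matrix `A_{I,L}` with entries `ω^{−l·i_p}`. -/
noncomputable def AIL (M P : ℕ) (ω : ℂ) (i : Fin P → Fin M) (L : ℕ) :
    Matrix (Fin P) (Fin (L + 1)) ℂ :=
  Matrix.of fun (p : Fin P) (l : Fin (L + 1)) =>
    ω ^ (-((l : ℕ) : ℤ) * ((i p : ℕ) : ℤ))

/-- The quantity `d` in the condition-number bound. -/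
noncomputable def dval (M P : ℕ) (δ nKP : ℝ) (L : ℕ) : ℝ :=
  (P : ℝ) * ((1 + nKP / (((P : ℝ) - 1) * (1 + (((L + 1 - P) / M : ℕ) : ℝ)) * δ ^ 2))
      ^ (((P : ℝ) - 1) / 2) - 1)

/-- The inductive step of `∏ (1 + aₖ) ≤ (1 + (∑ aₖ) / m) ^ m`. -/
theorem one_add_div_pow_mul_one_add_le (m : ℕ) {a b : ℝ} (ha : 0 ≤ a) (hb : 0 ≤ b) :
    (1 + a / m) ^ m * (1 + b) ≤ (1 + (a + b) / (m + 1 : ℕ)) ^ (m + 1) := by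
  rcases Nat.eq_zero_or_pos m with rfl | hm
  · simp; linarith
  have hm' : (0 : ℝ) < m := by exact_mod_cast hm
  have h := Real.geom_mean_le_arith_mean2_weighted (w₁ := m / (m + 1)) (w₂ := 1 / (m + 1))
    (p₁ := 1 + a / m) (p₂ := 1 + b) (by positivity) (by positivity) (by positivity)
    (by positivity) (by field_simp)
  have h2 : (m / (m + 1) * (1 + a / m) + 1 / (m + 1) * (1 + b) : ℝ)
      = 1 + (a + b) / (m + 1 : ℕ) := by
    push_cast; field_simp; ring
  rw [h2] at h
  have h3 := pow_le_pow_left₀ (by positivity) h (m + 1)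
  rw [mul_pow, ← Real.rpow_natCast, ← Real.rpow_natCast (_ ^ (1 / (m + 1) : ℝ)),
    ← Real.rpow_mul (by positivity), ← Real.rpow_mul (by positivity)] at h3
  have e1 : (m / (m + 1) : ℝ) * ((m + 1 : ℕ) : ℝ) = m := by push_cast; field_simp
  have e2 : (1 / (m + 1) : ℝ) * ((m + 1 : ℕ) : ℝ) = 1 := by push_cast; field_simp
  rw [e1, e2, Real.rpow_one, Real.rpow_natCast] at h3
  exact h3

/-- Solving `κ + 1/κ ≤ 2 + d`. -/
theorem le_of_add_inv_le {κ d : ℝ} (hκ : 0 < κ) (h : κ + κ⁻¹ ≤ 2 + d) :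
    κ ≤ 1 + (d + Real.sqrt (d ^ 2 + 4 * d)) / 2 := by
  have h1 : κ ^ 2 + 1 ≤ (2 + d) * κ := by
    have := mul_le_mul_of_nonneg_right h hκ.le
    rw [add_mul, inv_mul_cancel₀ hκ.ne'] at this
    nlinarith
  have h2 : 2 * κ - 2 - d ≤ Real.sqrt (d ^ 2 + 4 * d) := by
    apply Real.le_sqrt_of_sq_le
    nlinarith
  linarith

theorem half_mul_one_add_sqrt {d : ℝ} (hd : 0 ≤ d) :
    d / 2 * (1 + Real.sqrt (1 + 4 / d)) = (d + Real.sqrt (d ^ 2 + 4 * d)) / 2 := by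
  rcases hd.eq_or_lt with rfl | hd
  · simp
  have : d ^ 2 + 4 * d = d ^ 2 * (1 + 4 / d) := by field_simp
  rw [this, Real.sqrt_mul (by positivity), Real.sqrt_sq hd.le]
  ring

/-- The Frobenius condition number dominates the spectral one. -/
theorem sqrt_div_add_inv_le {n : ℕ} (μ : Fin n → ℝ) (hμ : ∀ k, 0 < μ k) {a b : Fin n}
    (hab : a ≠ b) :
    (√(μ a) / √(μ b) + (√(μ a) / √(μ b))⁻¹ + (n - 2)) ^ 2 ≤ (∑ k, μ k) * ∑ k, (μ k)⁻¹ := by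
  have h := Finset.sum_mul_sq_le_sq_mul_sq Finset.univ (fun k => √(μ k))
    (fun k => (√(μ (Equiv.swap a b k)))⁻¹)
  have e1 : ∑ k, √(μ k) ^ 2 = ∑ k, μ k :=
    Finset.sum_congr rfl fun k _ => Real.sq_sqrt (hμ k).le
  have e2 : ∑ k, ((√(μ (Equiv.swap a b k)))⁻¹) ^ 2 = ∑ k, (μ k)⁻¹ := by
    rw [Equiv.sum_comp (Equiv.swap a b) (fun k => ((√(μ k))⁻¹) ^ 2)]
    exact Finset.sum_congr rfl fun k _ => by rw [inv_pow, Real.sq_sqrt (hμ k).le]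
  have e3 : ∑ k, √(μ k) * (√(μ (Equiv.swap a b k)))⁻¹
      = √(μ a) / √(μ b) + (√(μ a) / √(μ b))⁻¹ + (n - 2) := by
    have hrest : ∑ k ∈ (Finset.univ.erase a).erase b, √(μ k) * (√(μ (Equiv.swap a b k)))⁻¹
        = n - 2 := by
      rw [Finset.sum_congr rfl (g := fun _ => (1 : ℝ))]
      · have hb : b ∈ Finset.univ.erase a := by simp [hab.symm]
        have hn : 2 ≤ n := by
          have := Finset.card_le_univ ({a, b} : Finset (Fin n))
          rwa [Finset.card_pair hab, Fintype.card_fin] at this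
        rw [Finset.sum_const, Finset.card_erase_of_mem hb,
          Finset.card_erase_of_mem (Finset.mem_univ a), Finset.card_fin, Nat.sub_sub,
          nsmul_eq_mul, mul_one, Nat.cast_sub hn]
        norm_num
      · intro k hk
        simp only [Finset.mem_erase] at hk
        rw [Equiv.swap_apply_of_ne_of_ne hk.2.1 hk.1]
        exact mul_inv_cancel₀ (Real.sqrt_pos.2 (hμ k)).ne'
    rw [← Finset.add_sum_erase _ _ (Finset.mem_univ a),
      ← Finset.add_sum_erase _ _ (show b ∈ Finset.univ.erase a by simp [hab.symm]), hrest]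
    simp only [Equiv.swap_apply_left, Equiv.swap_apply_right, inv_div]
    ring
  rwa [e1, e2, e3] at h

section DualVectors

variable {E : Type*} [NormedAddCommGroup E] [InnerProductSpace ℂ E]

/-- Let `F` be `T`-invariant, let `w ∈ F` represent a functional that is a left eigenvector of `T`
on `F` with eigenvalue `lam`, and let `x ∉ F` be an eigenvector of `T` with eigenvalue `μ` on the
unit circle. Then `w` can be corrected along a unit vector `q ⊥ F` so as to annihilate `x`, with a
controlled increase of its norm. -/
theorem exists_unit_correction {T : E →ₗ[ℂ] E} {K : E}
    (hT : ∀ y, ‖T y‖ ^ 2 ≤ ‖y‖ ^ 2 + ‖inner ℂ K y‖ ^ 2)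
    {F : Submodule ℂ E} [F.HasOrthogonalProjection] (hF : ∀ y ∈ F, T y ∈ F)
    {x : E} (hx : x ∉ F) {μ lam : ℂ} (hTx : T x = μ • x) (hμ : ‖μ‖ = 1)
    {w : E} (hw : w ∈ F) (hwT : ∀ y ∈ F, inner ℂ w (T y) = lam * inner ℂ w y)
    {δ : ℝ} (hδ : 0 < δ) (hlam : δ ≤ ‖lam - μ‖) :
    ∃ q ∈ F ⊔ Submodule.span ℂ {x}, q ∈ Fᗮ ∧ ‖q‖ = 1 ∧ ∃ c : ℂ,
      inner ℂ (w + c • q) x = 0 ∧ ‖c‖ ^ 2 ≤ ‖w‖ ^ 2 * (‖inner ℂ K q‖ ^ 2 / δ ^ 2) := by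
  set f := F.starProjection x with hf
  have hfF : f ∈ F := F.starProjection_apply_mem x
  have hr : x - f ∈ Fᗮ := F.sub_starProjection_mem_orthogonal x
  have hr0 : x - f ≠ 0 := fun h => hx (by rwa [sub_eq_zero.1 h])
  have hrn : (‖x - f‖ : ℂ) ≠ 0 := by simpa using hr0
  set a : ℂ := (‖x - f‖ : ℂ)⁻¹ with ha
  set q := a • (x - f) with hq
  have hqF : q ∈ Fᗮ := Fᗮ.smul_mem a hr
  have hqn : ‖q‖ = 1 := by
    rw [hq, norm_smul, ha, norm_inv, Complex.norm_real, norm_norm,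
      inv_mul_cancel₀ (norm_ne_zero_iff.2 hr0)]
  have hqx : x = (‖x - f‖ : ℂ) • q + f := by
    rw [hq, smul_smul, ha, mul_inv_cancel₀ hrn, one_smul, sub_add_cancel]
  have hqq : inner ℂ q q = (1 : ℂ) := by
    rw [inner_self_eq_norm_sq_to_K, hqn]; simp
  have hqy : ∀ y ∈ F, inner ℂ q y = (0 : ℂ) := (F.mem_orthogonal' q).1 hqF
  have hyq : ∀ y ∈ F, inner ℂ y q = (0 : ℂ) := (F.mem_orthogonal q).1 hqF
  have hqx1 : inner ℂ q x = (‖x - f‖ : ℂ) := by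
    conv_lhs => rw [hqx]
    rw [inner_add_right, inner_smul_right, hqq, hqy f hfF]; simp
  refine ⟨q, ?_, hqF, hqn, -(starRingEnd ℂ) (inner ℂ w x * a), ?_⟩
  · exact Submodule.smul_mem _ _ (Submodule.sub_mem _
      (Submodule.mem_sup_right (Submodule.mem_span_singleton_self x))
      (Submodule.mem_sup_left hfF))
  set c := -(starRingEnd ℂ) (inner ℂ w x * a) with hc
  have hcx : inner ℂ (w + c • q) x = 0 := by
    rw [inner_add_left, inner_smul_left, hqx1, hc, map_neg, Complex.conj_conj, ha]
    field_simp
    ring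
  refine ⟨hcx, ?_⟩
  have hwy : ∀ y ∈ F, inner ℂ (w + c • q) y = inner ℂ w y := fun y hy => by
    rw [inner_add_left, inner_smul_left, hqy y hy, mul_zero, add_zero]
  have hwq : inner ℂ (w + c • q) q = (starRingEnd ℂ) c := by
    rw [inner_add_left, inner_smul_left, hyq w hw, hqq, zero_add, mul_one]
  set n := T q - μ • q with hn
  have hnF : n ∈ F := by
    have : n = a • (μ • f - T f) := by
      rw [hn, hq, map_smul, map_sub, hTx]
      module
    rw [this]
    exact F.smul_mem _ (F.sub_mem (F.smul_mem _ hfF) (hF f hfF))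
  have hTq : T q = μ • q + n := by rw [hn]; abel
  have hnn : ‖n‖ ^ 2 ≤ ‖inner ℂ K q‖ ^ 2 := by
    have h1 := hT q
    have h2 := norm_add_sq_eq_norm_sq_add_norm_sq_of_inner_eq_zero (𝕜 := ℂ) (μ • q) n
      (by rw [inner_smul_left, hqy n hnF, mul_zero])
    rw [← hTq, norm_smul, hμ, hqn] at h2
    rw [hqn] at h1
    nlinarith
  have heig : inner ℂ (w + c • q) (T q) = lam * inner ℂ (w + c • q) q := by
    have e1 : T q = a • (μ • x - T f) := by rw [hq, map_smul, map_sub, hTx]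
    rw [e1, inner_smul_right, inner_sub_right, inner_smul_right, hcx, hwy _ (hF f hfF),
      hwT f hfF, hq, inner_smul_right, inner_sub_right, ← hq, hcx, hwy f hfF]
    ring
  have hkey : (lam - μ) * (starRingEnd ℂ) c = inner ℂ w n := by
    rw [hTq, inner_add_right, inner_smul_right, hwq, hwy n hnF] at heig
    linear_combination -heig
  have h1 : δ * ‖c‖ ≤ ‖w‖ * ‖n‖ := by
    calc δ * ‖c‖ ≤ ‖lam - μ‖ * ‖c‖ := by gcongr
      _ = ‖inner ℂ w n‖ := by rw [← hkey, norm_mul, RCLike.norm_conj]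
      _ ≤ _ := norm_inner_le_norm w n
  have h2 : (δ * ‖c‖) ^ 2 ≤ ‖w‖ ^ 2 * ‖inner ℂ K q‖ ^ 2 := by
    calc (δ * ‖c‖) ^ 2 ≤ (‖w‖ * ‖n‖) ^ 2 := by gcongr
      _ = ‖w‖ ^ 2 * ‖n‖ ^ 2 := by ring
      _ ≤ _ := by gcongr
  rw [← mul_div_assoc, le_div_iff₀ (by positivity)]
  linarith [h2, mul_pow δ ‖c‖ 2]

variable {ι : Type*} [DecidableEq ι]

/-- Dual vectors relative to a finite set of eigenvectors; `k` is the orthogonal projection of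
`K`. -/
theorem exists_dual_vector_of_finset {T : E →ₗ[ℂ] E} {K : E}
    (hT : ∀ y, ‖T y‖ ^ 2 ≤ ‖y‖ ^ 2 + ‖inner ℂ K y‖ ^ 2)
    {v : ι → E} (hv : LinearIndependent ℂ v) {μ : ι → ℂ} (hTv : ∀ j, T (v j) = μ j • v j)
    (hμ : ∀ j, ‖μ j‖ = 1) {δ : ℝ} (hδ : 0 < δ) {p : ι} (hδμ : ∀ j, j ≠ p → δ ≤ ‖μ p - μ j‖)
    (s : Finset ι) (hs : p ∉ s) :
    ∃ w ∈ Submodule.span ℂ (v '' ↑(insert p s)), ∃ k ∈ Submodule.span ℂ (v '' ↑(insert p s)),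
      inner ℂ w (v p) = (1 : ℂ) ∧ (∀ j ∈ s, inner ℂ w (v j) = (0 : ℂ)) ∧
      inner ℂ k K = ((‖k‖ ^ 2 : ℝ) : ℂ) ∧
      ‖w‖ ^ 2 ≤ (‖v p‖ ^ 2)⁻¹ * (1 + (‖k‖ ^ 2 / δ ^ 2) / s.card) ^ s.card := by
  induction s using Finset.induction_on with
  | empty =>
    have hvp : ‖v p‖ ≠ 0 := norm_ne_zero_iff.2 (hv.ne_zero p)
    have hvp' : (‖v p‖ : ℂ) ≠ 0 := by exact_mod_cast hvp
    refine ⟨((‖v p‖ : ℂ) ^ 2)⁻¹ • v p,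
      Submodule.smul_mem _ _ (Submodule.subset_span ⟨p, by simp, rfl⟩), 0,
      Submodule.zero_mem _, ?_, by simp, by simp, ?_⟩
    · rw [inner_smul_left, inner_self_eq_norm_sq_to_K]
      simp [hvp']
    · rw [norm_smul, norm_inv, norm_pow, Complex.norm_real, norm_norm]
      apply le_of_eq
      simp
      field_simp
  | insert j s hj ih =>
    have hps : p ∉ s := fun h => hs (Finset.mem_insert_of_mem h)
    have hjp : j ≠ p := fun h => hs (h ▸ Finset.mem_insert_self j s)
    obtain ⟨w, hw, k, hk, hwp, hws, hkK, hwn⟩ := ih hps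
    set F := Submodule.span ℂ (v '' ↑(insert p s)) with hFdef
    have hfin : FiniteDimensional ℂ F :=
      FiniteDimensional.span_of_finite ℂ ((Finset.finite_toSet _).image v)
    have hF : ∀ y ∈ F, T y ∈ F := fun y hy => by
      induction hy using Submodule.span_induction with
      | mem y hy =>
        obtain ⟨l, hl, rfl⟩ := hy
        rw [hTv]
        exact F.smul_mem _ (Submodule.subset_span ⟨l, hl, rfl⟩)
      | zero => simp
      | add y z _ _ hy hz => rw [map_add]; exact F.add_mem hy hz
      | smul a y _ hy => rw [map_smul]; exact F.smul_mem a hy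
    have hwT : ∀ y ∈ F, inner ℂ w (T y) = μ p * inner ℂ w y := fun y hy => by
      induction hy using Submodule.span_induction with
      | mem y hy =>
        obtain ⟨l, hl, rfl⟩ := hy
        rw [hTv, inner_smul_right]
        rcases Finset.mem_insert.1 (Finset.mem_coe.1 hl) with rfl | hl
        · rfl
        · rw [hws l hl, mul_zero, mul_zero]
      | zero => simp
      | add y z _ _ hy hz => rw [map_add, inner_add_right, inner_add_right, hy, hz, mul_add]
      | smul a y _ hy => rw [map_smul, inner_smul_right, inner_smul_right, hy]; ring
    have hjF : v j ∉ F := hv.notMem_span_image (by simp [hj, hjp])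
    obtain ⟨q, hq, hqF, hqn, c, hcx, hcn⟩ :=
      exists_unit_correction hT hF hjF (hTv j) (hμ j) hw hwT hδ (hδμ j hjp)
    have hle : F ⊔ Submodule.span ℂ {v j} ≤
        Submodule.span ℂ (v '' ↑(insert p (insert j s))) := by
      refine sup_le (Submodule.span_mono (Set.image_mono ?_)) (Submodule.span_mono ?_)
      · intro l; simp; tauto
      · simp
    have hFle := le_sup_left.trans hle
    have hqy : ∀ y ∈ F, inner ℂ q y = (0 : ℂ) := (F.mem_orthogonal' q).1 hqF
    have hyq : ∀ y ∈ F, inner ℂ y q = (0 : ℂ) := (F.mem_orthogonal q).1 hqF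
    have hpyth : ∀ y ∈ F, ∀ b : ℂ, ‖y + b • q‖ ^ 2 = ‖y‖ ^ 2 + ‖b‖ ^ 2 := fun y hy b => by
      have := norm_add_sq_eq_norm_sq_add_norm_sq_of_inner_eq_zero (𝕜 := ℂ) y (b • q)
        (by rw [inner_smul_right, hyq y hy, mul_zero])
      rw [norm_smul, hqn, mul_one] at this
      nlinarith
    have hwy : ∀ y ∈ F, inner ℂ (w + c • q) y = inner ℂ w y := fun y hy => by
      rw [inner_add_left, inner_smul_left, hqy y hy, mul_zero, add_zero]
    refine ⟨w + c • q, Submodule.add_mem _ (hFle hw) (Submodule.smul_mem _ _ (hle hq)),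
      k + (inner ℂ q K : ℂ) • q,
      Submodule.add_mem _ (hFle hk) (Submodule.smul_mem _ _ (hle hq)), ?_, ?_, ?_, ?_⟩
    · rw [hwy _ (Submodule.subset_span ⟨p, by simp, rfl⟩), hwp]
    · intro l hl
      rcases Finset.mem_insert.1 hl with rfl | hl
      · exact hcx
      · rw [hwy _ (Submodule.subset_span ⟨l, by simp [hl], rfl⟩), hws l hl]
    · rw [hpyth k hk, inner_add_left, hkK, inner_smul_left, Complex.conj_mul']
      push_cast
      rfl
    · rw [hpyth w hw, hpyth k hk, Finset.card_insert_of_notMem hj]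
      have hb : ‖(inner ℂ K q : ℂ)‖ = ‖(inner ℂ q K : ℂ)‖ := norm_inner_symm K q
      rw [hb] at hcn
      have hstep := one_add_div_pow_mul_one_add_le s.card
        (a := ‖k‖ ^ 2 / δ ^ 2) (b := ‖(inner ℂ q K : ℂ)‖ ^ 2 / δ ^ 2) (by positivity) (by positivity)
      rw [← add_div] at hstep
      calc ‖w‖ ^ 2 + ‖c‖ ^ 2 ≤ ‖w‖ ^ 2 * (1 + ‖(inner ℂ q K : ℂ)‖ ^ 2 / δ ^ 2) := by linarith
        _ ≤ ((‖v p‖ ^ 2)⁻¹ * (1 + (‖k‖ ^ 2 / δ ^ 2) / s.card) ^ s.card)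
            * (1 + ‖(inner ℂ q K : ℂ)‖ ^ 2 / δ ^ 2) := by gcongr
        _ ≤ _ := by
          rw [mul_assoc]
          gcongr

/-- Dual vectors of a finite system of eigenvectors of a near-isometry `T` whose eigenvalues lie on
the unit circle and are separated by `δ`. -/
theorem exists_dual_vector_norm_sq_le [Fintype ι] {T : E →ₗ[ℂ] E} {K : E}
    (hT : ∀ y, ‖T y‖ ^ 2 ≤ ‖y‖ ^ 2 + ‖inner ℂ K y‖ ^ 2)
    {v : ι → E} (hv : LinearIndependent ℂ v) {μ : ι → ℂ} (hTv : ∀ j, T (v j) = μ j • v j)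
    (hμ : ∀ j, ‖μ j‖ = 1) {δ : ℝ} (hδ : 0 < δ) (p : ι) (hδμ : ∀ j, j ≠ p → δ ≤ ‖μ p - μ j‖) :
    ∃ w : E, (∀ j, inner ℂ w (v j) = if j = p then (1 : ℂ) else 0) ∧
      ‖w‖ ^ 2 ≤ (‖v p‖ ^ 2)⁻¹ *
        (1 + (‖K‖ ^ 2 / δ ^ 2) / (Fintype.card ι - 1 : ℕ)) ^ (Fintype.card ι - 1) := by
  obtain ⟨w, -, k, -, hwp, hws, hkK, hwn⟩ := exists_dual_vector_of_finset hT hv hTv hμ hδ hδμ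
    (Finset.univ.erase p) (Finset.notMem_erase p _)
  refine ⟨w, fun j => ?_, ?_⟩
  · split_ifs with h
    · rw [h, hwp]
    · exact hws j (by simp [h])
  · have hk : ‖k‖ ≤ ‖K‖ := by
      have h := norm_inner_le_norm (𝕜 := ℂ) k K
      rw [hkK, Complex.norm_real, Real.norm_of_nonneg (by positivity), sq] at h
      rcases (norm_nonneg k).eq_or_lt with h0 | h0
      · rw [← h0]; positivity
      · exact le_of_mul_le_mul_left h h0
    rw [Finset.card_erase_of_mem (Finset.mem_univ p), Finset.card_univ] at hwn
    refine hwn.trans ?_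
    gcongr

end DualVectors

section ConditionNumber

variable {m n : ℕ}

theorem eigenvalues_pos_of_mul_eq_one {A : Matrix (Fin m) (Fin n) ℂ}
    {W : Matrix (Fin n) (Fin m) ℂ} (h : A * W = 1) (k : Fin m) :
    0 < (Matrix.isHermitian_mul_conjTranspose_self A).eigenvalues k := by
  open scoped ComplexOrder in
  refine (Matrix.PosDef.mul_conjTranspose_self A fun x y hxy => ?_).eigenvalues_pos k
  have := congrArg (fun u => u ᵥ* W) hxy
  simpa [Matrix.vecMul_vecMul, h] using this

/-- The pseudo-inverse has the least Frobenius norm among the right inverses. -/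
theorem sum_inv_eigenvalues_le {A : Matrix (Fin m) (Fin n) ℂ}
    {W : Matrix (Fin n) (Fin m) ℂ} (h : A * W = 1) :
    ∑ k, ((Matrix.isHermitian_mul_conjTranspose_self A).eigenvalues k)⁻¹
      ≤ ∑ p, ∑ l, ‖W l p‖ ^ 2 := by
  set hA := Matrix.isHermitian_mul_conjTranspose_self A
  set U : Matrix (Fin m) (Fin m) ℂ := (hA.eigenvectorUnitary).1
  have hUU : Uᴴ * U = 1 := Unitary.coe_star_mul_self hA.eigenvectorUnitary
  have hUU' : U * Uᴴ = 1 := Unitary.coe_mul_star_self hA.eigenvectorUnitary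
  set D : Matrix (Fin m) (Fin m) ℂ := Matrix.diagonal (fun k => (hA.eigenvalues k : ℂ)) with hD
  set D' : Matrix (Fin m) (Fin m) ℂ := Matrix.diagonal (fun k => ((hA.eigenvalues k)⁻¹ : ℂ))
    with hD'
  have hDD : D * D' = 1 := by
    rw [hD, hD', Matrix.diagonal_mul_diagonal, ← Matrix.diagonal_one]
    congr 1
    funext k
    exact mul_inv_cancel₀ (by exact_mod_cast (eigenvalues_pos_of_mul_eq_one h k).ne')
  have hspec : A * Aᴴ = U * D * Uᴴ := by
    have := hA.spectral_theorem
    rw [Unitary.conjStarAlgAut_apply] at this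
    exact this
  set R := U * D' * Uᴴ with hR
  have hRH : Rᴴ = R := by
    rw [hR, Matrix.conjTranspose_mul, Matrix.conjTranspose_mul, Matrix.conjTranspose_conjTranspose,
      hD', Matrix.diagonal_conjTranspose, Matrix.mul_assoc]
    congr 3
    funext k
    simp
  have hGR : A * Aᴴ * R = 1 := by
    calc A * Aᴴ * R = U * (D * ((Uᴴ * U) * D')) * Uᴴ := by
          rw [hspec, hR]; simp only [Matrix.mul_assoc]
      _ = 1 := by rw [hUU, Matrix.one_mul, hDD, Matrix.mul_one, hUU']
  have hWA : Wᴴ * Aᴴ = 1 := by rw [← Matrix.conjTranspose_mul, h, Matrix.conjTranspose_one]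
  have hexp : (W - Aᴴ * R)ᴴ * (W - Aᴴ * R) = Wᴴ * W - R := by
    rw [Matrix.conjTranspose_sub, Matrix.conjTranspose_mul, Matrix.conjTranspose_conjTranspose,
      hRH, Matrix.sub_mul, Matrix.mul_sub, Matrix.mul_sub, ← Matrix.mul_assoc Wᴴ, hWA,
      Matrix.one_mul, Matrix.mul_assoc R A W, h, Matrix.mul_one, Matrix.mul_assoc R A,
      ← Matrix.mul_assoc A, hGR, Matrix.mul_one, sub_self, sub_zero]
  have htrR : R.trace = ((∑ k, (hA.eigenvalues k)⁻¹ : ℝ) : ℂ) := by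
    rw [hR, Matrix.trace_mul_cycle, hUU, Matrix.one_mul, hD', Matrix.trace_diagonal]
    push_cast
    rfl
  have htrW : (Wᴴ * W).trace = ((∑ p, ∑ l, ‖W l p‖ ^ 2 : ℝ) : ℂ) := by
    simp only [Matrix.trace, Matrix.diag_apply, Matrix.mul_apply, Matrix.conjTranspose_apply]
    push_cast
    exact Finset.sum_congr rfl fun p _ => Finset.sum_congr rfl fun l _ => Complex.conj_mul' _
  open scoped ComplexOrder in
  have hnn := (Matrix.posSemidef_conjTranspose_mul_self (W - Aᴴ * R)).trace_nonneg
  rw [hexp, Matrix.trace_sub, htrR, htrW, ← Complex.ofReal_sub, Complex.zero_le_real] at hnn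
  linarith

theorem sum_eigenvalues_eq (A : Matrix (Fin m) (Fin n) ℂ) :
    ∑ k, (Matrix.isHermitian_mul_conjTranspose_self A).eigenvalues k = ∑ p, ∑ l, ‖A p l‖ ^ 2 := by
  have h := (Matrix.isHermitian_mul_conjTranspose_self A).trace_eq_sum_eigenvalues
  have htr : (A * Aᴴ).trace = ((∑ p, ∑ l, ‖A p l‖ ^ 2 : ℝ) : ℂ) := by
    simp only [Matrix.trace, Matrix.diag_apply, Matrix.mul_apply, Matrix.conjTranspose_apply]
    push_cast
    exact Finset.sum_congr rfl fun p _ => Finset.sum_congr rfl fun l _ => Complex.mul_conj' _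
  rw [htr] at h
  exact Complex.ofReal_injective (by push_cast at h ⊢; exact h.symm)

/-- The condition number of a matrix with a right inverse, in terms of extremal eigenvalues. -/
theorem exists_cond2_eq [NeZero m] {A : Matrix (Fin m) (Fin n) ℂ}
    {W : Matrix (Fin n) (Fin m) ℂ} (h : A * W = 1) :
    ∃ a b, cond2 A = √((Matrix.isHermitian_mul_conjTranspose_self A).eigenvalues a) /
        √((Matrix.isHermitian_mul_conjTranspose_self A).eigenvalues b) ∧ 1 ≤ cond2 A := by
  set μ := (Matrix.isHermitian_mul_conjTranspose_self A).eigenvalues with hμ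
  obtain ⟨a, ha⟩ := exists_eq_ciSup_of_finite (f := μ)
  obtain ⟨b, hb⟩ := exists_eq_ciInf_of_finite (f := μ)
  have hc : cond2 A = √(μ a) / √(μ b) := by
    rw [cond2, sigmaMax, sigmaMin, ← hμ, ha, hb]
  refine ⟨a, b, hc, ?_⟩
  rw [hc, one_le_div (Real.sqrt_pos.2 (eigenvalues_pos_of_mul_eq_one h b))]
  apply Real.sqrt_le_sqrt
  rw [ha]
  exact le_ciSup (Set.finite_range μ).bddAbove b

theorem one_le_cond2 [NeZero m] {A : Matrix (Fin m) (Fin n) ℂ}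
    {W : Matrix (Fin n) (Fin m) ℂ} (h : A * W = 1) : 1 ≤ cond2 A := by
  obtain ⟨_, _, _, h⟩ := exists_cond2_eq h
  exact h

/-- A bound on the condition number by the Frobenius norms of `A` and of a right inverse. -/
theorem cond2_le_of_frobenius [NeZero m] {A : Matrix (Fin m) (Fin n) ℂ}
    {W : Matrix (Fin n) (Fin m) ℂ} (h : A * W = 1) {d : ℝ} (hd : 0 ≤ d)
    (hF : (∑ p, ∑ l, ‖A p l‖ ^ 2) * ∑ p, ∑ l, ‖W l p‖ ^ 2 ≤ (m + d) ^ 2) :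
    cond2 A ≤ 1 + (d + √(d ^ 2 + 4 * d)) / 2 := by
  obtain ⟨a, b, hab, hone⟩ := exists_cond2_eq h
  set μ := (Matrix.isHermitian_mul_conjTranspose_self A).eigenvalues with hμ
  have hpos := eigenvalues_pos_of_mul_eq_one h
  rw [hab] at hone ⊢
  rcases eq_or_ne a b with rfl | hne
  · rw [div_self (Real.sqrt_pos.2 (hpos a)).ne']
    have : 0 ≤ (d + √(d ^ 2 + 4 * d)) / 2 := by positivity
    linarith
  apply le_of_add_inv_le (by linarith)
  have h1 := sqrt_div_add_inv_le μ hpos hne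
  have h2 : (∑ k, μ k) * ∑ k, (μ k)⁻¹ ≤ (m + d) ^ 2 := by
    refine le_trans ?_ hF
    rw [hμ, sum_eigenvalues_eq]
    exact mul_le_mul_of_nonneg_left (sum_inv_eigenvalues_le h) (by positivity)
  have h3 := abs_le_of_sq_le_sq (h1.trans h2) (by positivity)
  linarith [le_of_abs_le h3]

end ConditionNumber

section Vandermonde

/-- Averaging shifted copies of a short predictor over `M`-th roots of unity gives a long predictor
of small norm. -/
theorem exists_predictor {M N L : ℕ} (hM : 0 < M) (hNM : N + 1 ≤ M) (hNL : N ≤ L) {ι : Type*}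
    {z : ι → ℂ} (hz : ∀ p, z p ^ M = 1) {κ : Fin (N + 1) → ℂ}
    (hκ : ∀ p, ∑ l, κ l * z p ^ (l : ℕ) = (z p)⁻¹) :
    ∃ K : Fin (L + 1) → ℂ, (∀ p, ∑ l, K l * z p ^ (l : ℕ) = (z p)⁻¹) ∧
      ∑ l, ‖K l‖ ^ 2 = (∑ l, ‖κ l‖ ^ 2) / (1 + ((L - N) / M : ℕ)) := by
  set q := (L - N) / M with hq
  have hqM : q * M ≤ L - N := Nat.div_mul_le_self _ _
  have hlt : ∀ x : Fin (q + 1) × Fin (N + 1), (x.1 : ℕ) * M + x.2 < L + 1 := fun x => by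
    have h1 : (x.1 : ℕ) * M ≤ q * M := Nat.mul_le_mul_right _ (by omega)
    omega
  set e : Fin (q + 1) × Fin (N + 1) → Fin (L + 1) := fun x => ⟨x.1 * M + x.2, hlt x⟩ with he
  have hinj : Function.Injective e := fun x y hxy => by
    have h : (x.1 : ℕ) * M + x.2 = y.1 * M + y.2 := congrArg Fin.val hxy
    have hx : (x.2 : ℕ) < M := by omega
    have hy : (y.2 : ℕ) < M := by omega
    have h2 : (x.2 : ℕ) = y.2 := by
      have := congrArg (· % M) h
      simpa [Nat.mul_add_mod_self_right, Nat.mod_eq_of_lt hx, Nat.mod_eq_of_lt hy] using this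
    have h1 : (x.1 : ℕ) = y.1 := Nat.eq_of_mul_eq_mul_right hM (by omega)
    exact Prod.ext (Fin.ext h1) (Fin.ext h2)
  have hq0 : (1 + q : ℂ) ≠ 0 := by
    rw [add_comm]
    exact Nat.cast_add_one_ne_zero q
  refine ⟨Function.extend e (fun x => κ x.2 / (1 + q)) 0, fun p => ?_, ?_⟩
  · rw [← Fintype.sum_of_injective e hinj
      (fun x => (1 + q : ℂ)⁻¹ * (κ x.2 * z p ^ (x.2 : ℕ)))]
    · rw [Fintype.sum_prod_type]
      simp only [← Finset.mul_sum, hκ p]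
      rw [Finset.sum_const, Finset.card_fin, nsmul_eq_mul, ← mul_assoc, Nat.cast_add_one,
        add_comm (q : ℂ), inv_mul_cancel₀ hq0, one_mul]
    · intro l hl
      rw [Function.extend_apply' _ _ _ (by simpa using hl)]
      simp
    · intro x
      rw [hinj.extend_apply, he]
      simp only
      rw [pow_add, mul_comm _ M, pow_mul, hz p, one_pow]
      ring
  · rw [← Fintype.sum_of_injective e hinj (fun x => ((1 + q : ℝ) ^ 2)⁻¹ * ‖κ x.2‖ ^ 2)]
    · rw [Fintype.sum_prod_type]
      simp only [← Finset.mul_sum]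
      rw [Finset.sum_const, Finset.card_fin, nsmul_eq_mul, Nat.cast_add_one]
      field_simp
      ring
    · intro l hl
      rw [Function.extend_apply' _ _ _ (by simpa using hl)]
      simp
    · intro x
      have hn : ‖(1 + q : ℂ)‖ = 1 + q := by
        rw [← Nat.cast_one, ← Nat.cast_add, Complex.norm_natCast]
        push_cast
        rfl
      rw [hinj.extend_apply, norm_div, hn, div_pow, div_eq_inv_mul]

/-- The transposed companion operator `x ↦ (∑ K_l x_l, x_0, …, x_{L-1})`. -/
noncomputable def companionOp {L : ℕ} (K : Fin (L + 1) → ℂ) :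
    EuclideanSpace ℂ (Fin (L + 1)) →ₗ[ℂ] EuclideanSpace ℂ (Fin (L + 1)) where
  toFun x := WithLp.toLp 2 (Fin.cons (∑ l, K l * x l) fun l : Fin L => x l.castSucc)
  map_add' x y := by
    ext l
    refine Fin.cases ?_ (fun l => ?_) l
    · simp [mul_add, Finset.sum_add_distrib]
    · simp
  map_smul' a x := by
    ext l
    refine Fin.cases ?_ (fun l => ?_) l
    · simp only [Fin.cons_zero, PiLp.smul_apply, smul_eq_mul, RingHom.id_apply, Finset.mul_sum]
      exact Finset.sum_congr rfl fun l _ => by ring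
    · simp

theorem norm_companionOp_sq_le {L : ℕ} (K : Fin (L + 1) → ℂ)
    (x : EuclideanSpace ℂ (Fin (L + 1))) :
    ‖companionOp K x‖ ^ 2 ≤ ‖x‖ ^ 2 +
      ‖inner ℂ (WithLp.toLp 2 fun l => (starRingEnd ℂ) (K l) : EuclideanSpace ℂ _) x‖ ^ 2 := by
  have hin : inner ℂ (WithLp.toLp 2 fun l => (starRingEnd ℂ) (K l) : EuclideanSpace ℂ _) x
      = ∑ l, K l * x l := by
    rw [PiLp.inner_apply]
    exact Finset.sum_congr rfl fun l _ => by simp [mul_comm]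
  rw [hin, EuclideanSpace.norm_sq_eq, EuclideanSpace.norm_sq_eq, Fin.sum_univ_succ,
    Fin.sum_univ_castSucc (fun l => ‖x l‖ ^ 2)]
  simp only [companionOp, LinearMap.coe_mk, AddHom.coe_mk, Fin.cons_zero, Fin.cons_succ]
  nlinarith [sq_nonneg ‖x (Fin.last L)‖]

theorem companionOp_powers {L : ℕ} {K : Fin (L + 1) → ℂ} {z : ℂ} (hz : z ≠ 0)
    (hK : ∑ l, K l * z ^ (l : ℕ) = z⁻¹) :
    companionOp K (WithLp.toLp 2 fun l => z ^ (l : ℕ)) =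
      z⁻¹ • (WithLp.toLp 2 fun l => z ^ (l : ℕ) : EuclideanSpace ℂ (Fin (L + 1))) := by
  ext l
  refine Fin.cases ?_ (fun l => ?_) l
  · simp [companionOp, hK]
  · simp only [companionOp, LinearMap.coe_mk, AddHom.coe_mk, Fin.cons_succ, Fin.val_castSucc,
      PiLp.smul_apply, Fin.val_succ, smul_eq_mul]
    rw [pow_succ]
    field_simp

/-- Rectangular Vandermonde matrices with separated nodes on the unit circle and a short predictor
have right inverses of small Frobenius norm. -/
theorem exists_right_inverse {P L : ℕ} {z : Fin P → ℂ} (hz : ∀ p, ‖z p‖ = 1) {δ : ℝ} (hδ : 0 < δ)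
    (hδz : ∀ j k, j ≠ k → δ ≤ ‖z j - z k‖) {K : Fin (L + 1) → ℂ}
    (hK : ∀ p, ∑ l, K l * z p ^ (l : ℕ) = (z p)⁻¹) :
    ∃ W : Matrix (Fin (L + 1)) (Fin P) ℂ,
      (Matrix.of fun (p : Fin P) (l : Fin (L + 1)) => z p ^ (l : ℕ)) * W = 1 ∧
      ∀ p, ∑ l, ‖W l p‖ ^ 2 ≤ (L + 1 : ℝ)⁻¹ *
        (1 + ((∑ l, ‖K l‖ ^ 2) / δ ^ 2) / (P - 1 : ℕ)) ^ (P - 1) := by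
  have hz0 : ∀ p, z p ≠ 0 := fun p => norm_ne_zero_iff.1 (by rw [hz p]; exact one_ne_zero)
  set v : Fin P → EuclideanSpace ℂ (Fin (L + 1)) := fun p => WithLp.toLp 2 fun l => z p ^ (l : ℕ)
    with hv
  have hTv : ∀ p, companionOp K (v p) = (z p)⁻¹ • v p := fun p => companionOp_powers (hz0 p) (hK p)
  have hv0 : ∀ p, v p ≠ 0 := fun p h => by
    have := congrArg (fun x : EuclideanSpace ℂ (Fin (L + 1)) => x 0) h
    simp [hv] at this
  have hzinj : Function.Injective z := fun j k hjk => by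
    by_contra hne
    have := hδz j k hne
    rw [hjk, sub_self, norm_zero] at this
    linarith
  have hli : LinearIndependent ℂ v :=
    Module.End.eigenvectors_linearIndependent' (companionOp K) (fun p => (z p)⁻¹)
      (inv_injective.comp hzinj) v
      fun p => ⟨Module.End.mem_eigenspace_iff.2 (hTv p), hv0 p⟩
  have hsep : ∀ p j, j ≠ p → δ ≤ ‖(z p)⁻¹ - (z j)⁻¹‖ := fun p j hjp => by
    rw [inv_sub_inv (hz0 p) (hz0 j), norm_div, norm_mul, hz, hz, mul_one, div_one]
    exact hδz j p hjp
  have hvn : ∀ p, ‖v p‖ ^ 2 = L + 1 := fun p => by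
    rw [EuclideanSpace.norm_sq_eq]
    simp [hv, hz]
  choose w hw hwn using fun p => exists_dual_vector_norm_sq_le (norm_companionOp_sq_le K) hli hTv
    (fun p => by rw [norm_inv, hz, inv_one]) hδ p (hsep p)
  refine ⟨Matrix.of fun l p => (starRingEnd ℂ) (w p l), ?_, fun p => ?_⟩
  · ext j p
    have := hw p j
    rw [PiLp.inner_apply] at this
    rw [Matrix.mul_apply, Matrix.one_apply, ← this]
    exact Finset.sum_congr rfl fun l _ => by simp [hv]
  · have := hwn p
    rw [hvn, EuclideanSpace.norm_sq_eq, EuclideanSpace.norm_sq_eq, Fintype.card_fin] at this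
    simpa using this

end Vandermonde

theorem dval_nonneg {M P : ℕ} (hP : 2 ≤ P) {δ x : ℝ} (hx : 0 ≤ x) (L : ℕ) :
    0 ≤ dval M P δ x L := by
  have hP' : (0 : ℝ) ≤ P - 1 := by
    have : (2 : ℝ) ≤ P := by exact_mod_cast hP
    linarith
  refine mul_nonneg (by positivity) (sub_nonneg.2 (Real.one_le_rpow ?_ (by positivity)))
  have : 0 ≤ x / (((P : ℝ) - 1) * (1 + (((L + 1 - P) / M : ℕ) : ℝ)) * δ ^ 2) := by positivity
  linarith

theorem tendsto_dval {M P : ℕ} (hM : 0 < M) (hP : 2 ≤ P) {δ : ℝ} (hδ : 0 < δ) (x : ℝ) :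
    Filter.Tendsto (dval M P δ x) Filter.atTop (nhds 0) := by
  have hP' : (0 : ℝ) < P - 1 := by
    have : (2 : ℝ) ≤ P := by exact_mod_cast hP
    linarith
  have h1 : Filter.Tendsto (fun L : ℕ => (L + 1 - P) / M) Filter.atTop Filter.atTop :=
    (Nat.tendsto_div_const_atTop hM.ne').comp
      ((Filter.tendsto_sub_atTop_nat P).comp (Filter.tendsto_add_atTop_nat 1))
  have h2 : Filter.Tendsto (fun L : ℕ => ((P : ℝ) - 1) * (1 + (((L + 1 - P) / M : ℕ) : ℝ)) * δ ^ 2)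
      Filter.atTop Filter.atTop :=
    ((Filter.tendsto_atTop_add_const_left _ _
      (tendsto_natCast_atTop_atTop.comp h1)).const_mul_atTop hP').atTop_mul_const (by positivity)
  have h3 := (((h2.const_div_atTop x).const_add 1).rpow_const
    (p := ((P : ℝ) - 1) / 2) (Or.inl (by norm_num))).sub_const 1 |>.const_mul (P : ℝ)
  simp only [add_zero, Real.one_rpow, sub_self, mul_zero] at h3
  exact h3

/-- Upper bound on the 2-norm condition number of `A_{I,L}`, and asymptotically
perfect conditioning `κ₂(A_{I,L}) → 1` as `L → ∞`. -/
theorem stmt16 (M P : ℕ) (hM : 0 < M) (hP : 2 ≤ P)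
    (ω : ℂ) (hω : ω = Complex.exp (-2 * Real.pi * Complex.I / M))
    (i : Fin P → Fin M) (hi : StrictMono i)
    (δ : ℝ)
    (hδ : IsLeast {r : ℝ | ∃ j k : Fin P, j < k ∧
      r = ‖ω ^ (-((i j : ℕ) : ℤ)) - ω ^ (-((i k : ℕ) : ℤ))‖} δ)
    (hδpos : 0 < δ)
    (KP : Fin (P - 1 + 1) → ℂ)
    (hKP : (AIL M P ω i (P - 1)).mulVec KP = fun p => ω ^ ((i p : ℕ))) :
    (∀ L : ℕ, P - 1 ≤ L →
      cond2 (AIL M P ω i L)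
        ≤ 1 + dval M P δ (∑ l, ‖KP l‖ ^ 2) L / 2
            * (1 + Real.sqrt (1 + 4 / dval M P δ (∑ l, ‖KP l‖ ^ 2) L))) ∧
    Filter.Tendsto (fun L : ℕ => cond2 (AIL M P ω i L)) Filter.atTop (nhds 1) := by
  have : NeZero P := ⟨by omega⟩
  set x := ∑ l, ‖KP l‖ ^ 2 with hx
  have hx0 : 0 ≤ x := by positivity
  have hωprim : IsPrimitiveRoot ω⁻¹ M := by
    have h : ω⁻¹ = Complex.exp (2 * Real.pi * Complex.I / M) := by
      rw [hω, ← Complex.exp_neg]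
      congr 1
      ring
    rw [h]
    exact Complex.isPrimitiveRoot_exp M hM.ne'
  have hωM : ω⁻¹ ^ M = 1 := hωprim.pow_eq_one
  set z : Fin P → ℂ := fun p => ω⁻¹ ^ (i p : ℕ) with hz
  have hzω : ∀ p, ω ^ (-((i p : ℕ) : ℤ)) = z p := fun p => by
    rw [_root_.zpow_neg, zpow_natCast, ← inv_pow]
  have hAIL : ∀ L, AIL M P ω i L =
      Matrix.of fun (p : Fin P) (l : Fin (L + 1)) => z p ^ (l : ℕ) := fun L => by
    ext p l
    rw [AIL, Matrix.of_apply, Matrix.of_apply, ← hzω, mul_comm, mul_neg, ← neg_mul,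
      _root_.zpow_mul,
      zpow_natCast]
  have hzM : ∀ p, z p ^ M = 1 := fun p => by
    rw [hz]
    simp only
    rw [← pow_mul, mul_comm, pow_mul, hωM, one_pow]
  have hzn : ∀ p, ‖z p‖ = 1 := fun p => Complex.norm_eq_one_of_pow_eq_one (hzM p) hM.ne'
  have hsep : ∀ j k, j ≠ k → δ ≤ ‖z j - z k‖ := fun j k hjk => by
    rcases lt_or_gt_of_ne hjk with h | h
    · exact hδ.2 ⟨j, k, h, by rw [hzω, hzω]⟩
    · rw [norm_sub_rev]
      exact hδ.2 ⟨k, j, h, by rw [hzω, hzω]⟩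
  have hKP' : ∀ p, ∑ l, KP l * z p ^ (l : ℕ) = (z p)⁻¹ := fun p => by
    have h := congrFun hKP p
    rw [hAIL, Matrix.mulVec, dotProduct] at h
    rw [show (z p)⁻¹ = ω ^ (i p : ℕ) by rw [hz]; simp, ← h]
    exact Finset.sum_congr rfl fun l _ => mul_comm _ _
  have hPM : P ≤ M := by simpa using Fintype.card_le_of_injective i hi.injective
  have hmain : ∀ L, P - 1 ≤ L → 1 ≤ cond2 (AIL M P ω i L) ∧
      cond2 (AIL M P ω i L) ≤
        1 + (dval M P δ x L + √(dval M P δ x L ^ 2 + 4 * dval M P δ x L)) / 2 := by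
    intro L hL
    obtain ⟨K, hK, hKn⟩ := exists_predictor hM (by omega) hL hzM hKP'
    obtain ⟨W, hW, hWn⟩ := exists_right_inverse hzn hδpos hsep hK
    rw [← hAIL] at hW
    refine ⟨one_le_cond2 hW, cond2_le_of_frobenius hW (dval_nonneg hP hx0 L) ?_⟩
    have hP1 : ((P - 1 : ℕ) : ℝ) = P - 1 := by rw [Nat.cast_sub (by omega), Nat.cast_one]
    have hP1pos : (0 : ℝ) < P - 1 := by
      have : (2 : ℝ) ≤ P := by exact_mod_cast hP
      linarith
    set B := 1 + x / (((P : ℝ) - 1) * (1 + (((L + 1 - P) / M : ℕ) : ℝ)) * δ ^ 2) with hB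
    have hB0 : 0 ≤ B := by positivity
    have hBeq : 1 + ((∑ l, ‖K l‖ ^ 2) / δ ^ 2) / (P - 1 : ℕ) = B := by
      rw [hKn, hB, hP1, show L - (P - 1) = L + 1 - P by omega, div_div, div_div]
      congr 2
      ring
    rw [hBeq] at hWn
    have hd : (P : ℝ) + dval M P δ x L = P * B ^ (((P : ℝ) - 1) / 2) := by
      rw [dval, ← hB]
      ring
    have hpow : (B ^ (((P : ℝ) - 1) / 2)) ^ 2 = B ^ (P - 1) := by
      rw [← Real.rpow_natCast, ← Real.rpow_mul hB0, ← Real.rpow_natCast, hP1]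
      congr 1
      push_cast
      ring
    have hAn : ∑ p, ∑ l, ‖AIL M P ω i L p l‖ ^ 2 = P * (L + 1) := by
      rw [hAIL]
      simp [hzn, mul_add]
    have hWs : ∑ p, ∑ l, ‖W l p‖ ^ 2 ≤ P * ((L + 1 : ℝ)⁻¹ * B ^ (P - 1)) := by
      refine (Finset.sum_le_sum fun p _ => hWn p).trans_eq ?_
      simp
    rw [hAn, hd, mul_pow, hpow]
    calc (P * (L + 1) : ℝ) * ∑ p, ∑ l, ‖W l p‖ ^ 2
        ≤ (P * (L + 1) : ℝ) * (P * ((L + 1 : ℝ)⁻¹ * B ^ (P - 1))) := by gcongr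
      _ = _ := by field_simp
  refine ⟨fun L hL => ?_, ?_⟩
  · rw [half_mul_one_add_sqrt (dval_nonneg hP hx0 L)]
    exact (hmain L hL).2
  · have hlim : Filter.Tendsto (fun L => 1 + (dval M P δ x L +
        √(dval M P δ x L ^ 2 + 4 * dval M P δ x L)) / 2) Filter.atTop (nhds 1) := by
      have hcont : Continuous fun d : ℝ => 1 + (d + √(d ^ 2 + 4 * d)) / 2 := by fun_prop
      have := (hcont.tendsto 0).comp (tendsto_dval hM hP hδpos x)
      simp only [ne_eq, OfNat.ofNat_ne_zero, not_false_eq_true, zero_pow, mul_zero, add_zero,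
        Real.sqrt_zero, zero_div] at this
      exact this
    refine tendsto_of_tendsto_of_tendsto_of_le_of_le' tendsto_const_nhds hlim ?_ ?_
    · filter_upwards [Filter.eventually_ge_atTop (P - 1)] with L hL using (hmain L hL).1
    · filter_upwards [Filter.eventually_ge_atTop (P - 1)] with L hL using (hmain L hL).2

end Stmt16
end
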